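/- arXiv:math/0701711 — 16 statements merged into one kernel-verified Lean document; each statement's English description precedes it below -/
import Mathlib

section
/- Let L be an LC-loop. Then: (i) L is left alternative, i.e., x·(x·y) = (x·x)·y for all x, y; (ii) L has the left inverse property, i.e., for every x there is x' with x'·x = e and x'·(x·y) = y for all y; (iii) x·x lies in the left nucleus of L for every x; (iv) x·x lies in the middle nucleus of L for every x. -/
/-- A loop: a set with a binary operation `*` and a two-sided identity `1` such that
all left and right translations are bijective (equivalently, the equations `a * x = b`
and `y * a = b` have unique solutions). -/
class Loop (L : Type*) extends Mul L, One L where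
  one_mul : ∀ a : L, 1 * a = a
  mul_one : ∀ a : L, a * 1 = a
  mulLeft_bijective : ∀ a : L, Function.Bijective fun b => a * b
  mulRight_bijective : ∀ a : L, Function.Bijective fun b => b * a

/-- Basic properties of LC-loops: left alternative, left inverse property,
left nuclear square and middle nuclear square. -/
theorem statement2 {L : Type*} [Loop L]
    (hLC : ∀ x y z : L, (x * x) * (y * z) = (x * (x * y)) * z) :
    (∀ x y : L, x * (x * y) = (x * x) * y) ∧
    (∀ x : L, ∃ x' : L, x' * x = 1 ∧ ∀ y : L, x' * (x * y) = y) ∧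
    (∀ x y z : L, (x * x) * (y * z) = ((x * x) * y) * z) ∧
    (∀ x y z : L, y * ((x * x) * z) = (y * (x * x)) * z) := by
  have cancel : ∀ a b c : L, a * b = a * c → b = c := fun a b c h =>
    (Loop.mulLeft_bijective a).1 h
  have leftAlt : ∀ x y : L, x * (x * y) = (x * x) * y := fun x y => by
    have h := hLC x y 1
    rw [Loop.mul_one, Loop.mul_one] at h
    exact h.symm
  have leftNuc : ∀ x y z : L, (x * x) * (y * z) = ((x * x) * y) * z := fun x y z => by
    rw [hLC, leftAlt]
  have mul_inv_cancel : ∀ x w : L, x * w = 1 → ∀ z, x * (w * z) = z := fun x w h z => by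
    apply cancel x
    rw [leftAlt, hLC, h, Loop.mul_one]
  have exists_inv : ∀ x : L, ∃ w, x * w = 1 ∧ w * x = 1 ∧ ∀ z, w * (x * z) = z := fun x => by
    obtain ⟨w, hw : x * w = 1⟩ := (Loop.mulLeft_bijective x).2 1
    have h : ∀ z, w * (x * z) = z := fun z => cancel x _ _ (mul_inv_cancel x w hw _)
    refine ⟨w, hw, ?_, h⟩
    have h1 := h 1
    rwa [Loop.mul_one] at h1
  refine ⟨leftAlt, fun x => ?_, leftNuc, fun x y z => ?_⟩
  · obtain ⟨w, -, h1, h2⟩ := exists_inv x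
    exact ⟨w, h1, h2⟩
  · obtain ⟨x', -, -, hx⟩ := exists_inv x
    obtain ⟨y', -, -, hy⟩ := exists_inv y
    have key : ∀ z, ((x' * x') * y') * (y * ((x * x) * z)) = z := fun z => by
      rw [← leftNuc, hy, ← leftAlt, ← leftAlt, hx, hx]
    have hone : ((x' * x') * y') * (y * (x * x)) = 1 := by
      have h := key 1
      rwa [Loop.mul_one] at h
    apply cancel ((x' * x') * y')
    rw [key, mul_inv_cancel _ _ hone]
end

section
/- The nucleus of a C-loop is a normal subloop: if L is a C-loop and N is its nucleus, then N is a subgroup of L and satisfies x·N = N·x, x·(y·N) = (x·y)·N, and x·(N·y) = (x·N)·y for all x, y ∈ L. -/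
/-- The nucleus of a loop: elements associating with all pairs. -/
def nucleus (L : Type*) [Loop L] : Set L :=
  {a | (∀ x y : L, a * (x * y) = (a * x) * y) ∧
       (∀ x y : L, x * (a * y) = (x * a) * y) ∧
       (∀ x y : L, x * (y * a) = (x * y) * a)}

namespace Loop

variable {L : Type*} [Loop L]

theorem one_mem_nucleus : (1 : L) ∈ nucleus L :=
  ⟨fun x y => by rw [one_mul, one_mul], fun x y => by rw [one_mul, mul_one],
    fun x y => by rw [mul_one, mul_one]⟩

theorem mul_mem_nucleus {a b : L} (ha : a ∈ nucleus L) (hb : b ∈ nucleus L) :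
    a * b ∈ nucleus L := by
  obtain ⟨al, am, ar⟩ := ha
  obtain ⟨bl, bm, br⟩ := hb
  exact ⟨fun x y => by rw [← al, bl, al, al], fun x y => by rw [← al, am, bm, br],
    fun x y => by rw [br, br, ar, br]⟩

/-- A C-loop has the inverse property. -/
theorem exists_inverse_property
    (hC : ∀ x y z : L, x * (y * (y * z)) = ((x * y) * y) * z) (y : L) :
    ∃ y' : L, y * y' = 1 ∧ y' * y = 1 ∧
      (∀ x : L, (x * y) * y' = x) ∧ (∀ x : L, (x * y') * y = x) ∧
      (∀ x : L, y' * (y * x) = x) ∧ (∀ x : L, y * (y' * x) = x) := by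
  obtain ⟨y', hy : y * y' = 1⟩ := (mulLeft_bijective y).2 1
  obtain ⟨w, hw : w * y = 1⟩ := (mulRight_bijective y).2 1
  have hr (x : L) : (x * y) * y' = x := by
    obtain ⟨u, rfl : u * y = x⟩ := (mulRight_bijective y).2 x
    rw [← hC, hy, mul_one]
  have hw' : y' = w := by
    have h := hr w
    rwa [hw, one_mul] at h
  subst hw'
  have hl (x : L) : y' * (y * x) = x := by
    obtain ⟨u, rfl : y * u = x⟩ := (mulLeft_bijective y).2 x
    rw [hC, hw, one_mul]
  refine ⟨y', hy, hw, hr, fun x => ?_, hl, fun x => ?_⟩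
  · exact (mulRight_bijective y').1 (hr (x * y'))
  · exact (mulLeft_bijective y').1 (hl (y' * x))

/-- In a C-loop, the middle nucleus is contained in the nucleus. -/
theorem mem_nucleus_of_middle
    (hC : ∀ x y z : L, x * (y * (y * z)) = ((x * y) * y) * z) {a : L}
    (ha : ∀ x y : L, x * (a * y) = (x * a) * y) : a ∈ nucleus L := by
  choose inv hri hli hrr hrr' hll hll' using exists_inverse_property hC
  have inv_mul (x y : L) : inv (x * y) = inv y * inv x := by
    have h : inv x = y * inv (x * y) := by
      rw [← hrr (x * y) (inv x), hll]
    rw [h, hll]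
  have inv_inv (x : L) : inv (inv x) = x := by
    have h := hll (inv x) x
    rwa [hli, mul_one] at h
  refine ⟨fun x y => ?_, ha, fun x y => ?_⟩
  · have h := ha (inv x * inv a) (x * y)
    rw [hrr', hll] at h
    have hx : inv (inv x * inv a) = a * x := by rw [inv_mul, inv_inv, inv_inv]
    rw [← hll (inv x * inv a) (a * (x * y)), h, hx]
  · have h := ha (x * y) (inv a * inv y)
    rw [hll', hrr] at h
    have hy : inv (inv a * inv y) = y * a := by rw [inv_mul, inv_inv, inv_inv]
    rw [← hrr (inv a * inv y) ((x * y) * a), ← h, hy]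

theorem exists_inverse_mem_nucleus
    (hC : ∀ x y z : L, x * (y * (y * z)) = ((x * y) * y) * z) {a : L}
    (ha : a ∈ nucleus L) : ∃ b ∈ nucleus L, a * b = 1 ∧ b * a = 1 := by
  obtain ⟨b, hab, hba, hr, hr', -, hl'⟩ := exists_inverse_property hC a
  refine ⟨b, mem_nucleus_of_middle hC fun x y => ?_, hab, hba⟩
  obtain ⟨u, rfl : u * a = x⟩ := (mulRight_bijective a).2 x
  rw [hr, ← ha.2.1, hl']

/-- Squares in a C-loop are nuclear. -/
theorem mul_self_mem_nucleus
    (hC : ∀ x y z : L, x * (y * (y * z)) = ((x * y) * y) * z) (y : L) :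
    y * y ∈ nucleus L := by
  refine mem_nucleus_of_middle hC fun x z => ?_
  have h₁ := hC 1 y z
  have h₂ := hC x y 1
  rw [one_mul, one_mul] at h₁
  rw [mul_one, mul_one] at h₂
  rw [← h₁, hC, h₂]

theorem mul_mul_self_mem_nucleus
    (hC : ∀ x y z : L, x * (y * (y * z)) = ((x * y) * y) * z) (x : L) {n : L}
    (hn : n ∈ nucleus L) : (x * n) * x ∈ nucleus L := by
  obtain ⟨m, hm, hnm, -⟩ := exists_inverse_mem_nucleus hC hn
  have h := mul_mem_nucleus (mul_self_mem_nucleus hC (x * n)) hm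
  rwa [hn.2.2, ← hm.2.2, hnm, mul_one] at h

theorem image_mul_left_nucleus_eq
    (hC : ∀ x y z : L, x * (y * (y * z)) = ((x * y) * y) * z) (x : L) :
    (fun n => x * n) '' nucleus L = (fun n => n * x) '' nucleus L := by
  obtain ⟨y, -, -, hr, hr', hl, hl'⟩ := exists_inverse_property hC x
  have hy := mul_self_mem_nucleus hC y
  ext z
  constructor
  · rintro ⟨n, hn, rfl⟩
    refine ⟨(x * n * x) * (y * y), mul_mem_nucleus (mul_mul_self_mem_nucleus hC x hn) hy, ?_⟩
    change x * n * x * (y * y) * x = x * n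
    rw [(mul_mul_self_mem_nucleus hC x hn).1 y y, hr, hr']
  · rintro ⟨n, hn, rfl⟩
    refine ⟨(y * y) * (x * n * x), mul_mem_nucleus hy (mul_mul_self_mem_nucleus hC x hn), ?_⟩
    change x * (y * y * (x * n * x)) = n * x
    rw [← (mul_mul_self_mem_nucleus hC x hn).2.2 y y, ← hn.2.1, hl, hl']

end Loop

/-- The nucleus of a C-loop is a normal subloop (in fact a normal subgroup). -/
theorem statement3 {L : Type*} [Loop L]
    (hC : ∀ x y z : L, x * (y * (y * z)) = ((x * y) * y) * z) :
    (1 : L) ∈ nucleus L ∧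
    (∀ a ∈ nucleus L, ∀ b ∈ nucleus L, a * b ∈ nucleus L) ∧
    (∀ a ∈ nucleus L, ∃ b ∈ nucleus L, a * b = 1 ∧ b * a = 1) ∧
    (∀ x y : L,
      ((fun n => x * n) '' nucleus L = (fun n => n * x) '' nucleus L) ∧
      ((fun n => x * (y * n)) '' nucleus L = (fun n => (x * y) * n) '' nucleus L) ∧
      ((fun n => x * (n * y)) '' nucleus L = (fun n => (x * n) * y) '' nucleus L)) := by
  exact ⟨Loop.one_mem_nucleus, fun _ ha _ hb => Loop.mul_mem_nucleus ha hb,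
    fun _ ha => Loop.exists_inverse_mem_nucleus hC ha, fun x y =>
      ⟨Loop.image_mul_left_nucleus_eq hC x, Set.image_congr fun n hn => hn.2.2 x y,
        Set.image_congr fun n hn => hn.2.1 x y⟩⟩
end

section
/- Let L be a C-loop with nucleus N. Then the quotient loop L/N is a Steiner loop; equivalently, for all x, y ∈ L one has x·x ∈ N, (x·y)·N = (y·x)·N, and ((y·x)·x)·N = y·N. -/
namespace Loop

variable {L : Type*} [Loop L]

/-- The right inverse of an element of a loop. -/
noncomputable def inv (x : L) : L := ((mulLeft_bijective x).surjective 1).choose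

theorem mul_inv_self (x : L) : x * inv x = 1 := ((mulLeft_bijective x).surjective 1).choose_spec

theorem mul_left_cancel {a x y : L} (h : a * x = a * y) : x = y := (mulLeft_bijective a).injective h

theorem mul_right_cancel {a x y : L} (h : x * a = y * a) : x = y :=
  (mulRight_bijective a).injective h

theorem mul_mem_nucleus_s4 {m n : L} (hm : m ∈ nucleus L) (hn : n ∈ nucleus L) :
    m * n ∈ nucleus L := by
  obtain ⟨hm₁, hm₂, hm₃⟩ := hm
  obtain ⟨hn₁, hn₂, hn₃⟩ := hn
  refine ⟨fun x y => ?_, fun x y => ?_, fun x y => ?_⟩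
  · rw [← hm₁, hn₁, hm₁, hm₁]
  · rw [← hm₁, hm₂, hn₂, ← hm₂]
  · rw [hn₃ y m, hn₃ x, hm₃, hn₃ (x * y) m]

/-- The C-loop identity. -/
def IsCLoop (L : Type*) [Loop L] : Prop :=
  ∀ x y z : L, x * (y * (y * z)) = ((x * y) * y) * z

namespace IsCLoop

theorem mul_mul_self (hC : IsCLoop L) (x y : L) : x * (y * y) = (x * y) * y := by
  simpa only [mul_one] using hC x y 1

theorem self_mul_mul (hC : IsCLoop L) (x y : L) : x * (x * y) = (x * x) * y := by
  simpa only [one_mul] using hC 1 x y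

theorem mul_mul_inv (hC : IsCLoop L) (x y : L) : (x * y) * inv y = x := by
  obtain ⟨w, rfl⟩ := (mulRight_bijective y).surjective x
  have h := hC w y (inv y)
  rw [mul_inv_self, mul_one] at h
  exact h.symm

theorem inv_mul_self (hC : IsCLoop L) (x : L) : inv x * x = 1 := by
  obtain ⟨u, hu⟩ := (mulRight_bijective x).surjective 1
  have h := hC.mul_mul_inv u x
  simp only at hu
  rw [hu, one_mul] at h
  rw [h, hu]

theorem inv_mul_mul (hC : IsCLoop L) (x y : L) : inv x * (x * y) = y := by
  obtain ⟨w, rfl⟩ := (mulLeft_bijective x).surjective y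
  have h := hC (inv x) x w
  rwa [hC.inv_mul_self, one_mul] at h

theorem mul_inv_mul (hC : IsCLoop L) (x y : L) : x * (inv x * y) = y := by
  apply mul_left_cancel (a := inv x)
  rw [hC.inv_mul_mul]

theorem mul_mul_inv_left (hC : IsCLoop L) (x y : L) : (x * inv y) * y = x := by
  apply mul_right_cancel (a := inv y)
  rw [hC.mul_mul_inv]

theorem inv_inv (hC : IsCLoop L) (x : L) : inv (inv x) = x := by
  apply mul_left_cancel (a := inv x)
  rw [mul_inv_self, hC.inv_mul_self]

theorem inv_mul (hC : IsCLoop L) (x y : L) : inv (x * y) = inv y * inv x := by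
  have h := hC.inv_mul_mul (x * y) (inv y)
  rw [hC.mul_mul_inv] at h
  rw [← h, hC.mul_mul_inv]

/-- An element of the middle nucleus of a C-loop is in the nucleus. -/
theorem mem_nucleus_of_middle (hC : IsCLoop L) {a : L}
    (ha : ∀ x y : L, x * (a * y) = (x * a) * y) : a ∈ nucleus L := by
  refine ⟨fun x y => ?_, ha, fun x y => ?_⟩
  · have h := ha (inv (a * x)) (x * y)
    have e : inv (a * x) * a = inv x := by rw [hC.inv_mul, hC.mul_mul_inv_left]
    rw [e, hC.inv_mul_mul] at h
    rw [← hC.mul_inv_mul (a * x) (a * (x * y)), h]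
  · have h := ha (x * y) (inv (y * a))
    have e : a * inv (y * a) = inv y := by rw [hC.inv_mul, hC.mul_inv_mul]
    rw [e, hC.mul_mul_inv] at h
    rw [← hC.mul_mul_inv_left ((x * y) * a) (y * a), ← h]

theorem mul_self_mem_nucleus (hC : IsCLoop L) (x : L) : x * x ∈ nucleus L :=
  hC.mem_nucleus_of_middle fun y z => by
    rw [← hC.self_mul_mul, hC.mul_mul_self, hC]

theorem inv_mem_nucleus (hC : IsCLoop L) {n : L} (hn : n ∈ nucleus L) : inv n ∈ nucleus L :=
  hC.mem_nucleus_of_middle fun x y => by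
    have h := hn.2.1 (x * inv n) (inv n * y)
    rw [hC.mul_mul_inv_left, hC.mul_inv_mul] at h
    exact h.symm

theorem exists_inv_eq_mul (hC : IsCLoop L) (x : L) : ∃ n ∈ nucleus L, inv x = x * n :=
  ⟨inv x * inv x, hC.mul_self_mem_nucleus _, by rw [hC.mul_inv_mul]⟩

theorem mul_mul_mem_nucleus (hC : IsCLoop L) {n : L} (hn : n ∈ nucleus L) (x : L) :
    (x * n) * x ∈ nucleus L := by
  have h : ((x * n) * x) * n ∈ nucleus L := by
    rw [← hn.2.2]
    exact hC.mul_self_mem_nucleus _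
  simpa only [hC.mul_mul_inv] using mul_mem_nucleus_s4 h (hC.inv_mem_nucleus hn)

/-- Left cosets of the nucleus contain the corresponding right cosets. -/
theorem exists_mul_eq_mul (hC : IsCLoop L) {n : L} (hn : n ∈ nucleus L) (x : L) :
    ∃ m ∈ nucleus L, n * x = x * m := by
  obtain ⟨k, hk, hx⟩ := hC.exists_inv_eq_mul (inv x)
  rw [hC.inv_inv] at hx
  refine ⟨((inv x * n) * inv x) * k,
    mul_mem_nucleus_s4 (hC.mul_mul_mem_nucleus hn _) hk, ?_⟩
  rw [← hk.2.2, ← hx, ← hn.2.1, hC.mul_inv_mul]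

theorem exists_mul_comm_mod_nucleus (hC : IsCLoop L) (x y : L) :
    ∃ n ∈ nucleus L, x * y = (y * x) * n := by
  obtain ⟨k, hk, hkx⟩ := hC.exists_inv_eq_mul x
  obtain ⟨m, hm, hmy⟩ := hC.exists_inv_eq_mul y
  obtain ⟨m', hm', hmx⟩ := hC.exists_mul_eq_mul hm x
  obtain ⟨s, hs, hsxy⟩ := hC.exists_inv_eq_mul (inv (x * y))
  refine ⟨(m' * k) * s, mul_mem_nucleus_s4 (mul_mem_nucleus_s4 hm' hk) hs, ?_⟩
  calc x * y = inv (x * y) * s := by rw [← hsxy, hC.inv_inv]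
    _ = ((y * m) * (x * k)) * s := by rw [hC.inv_mul, hkx, hmy]
    _ = (y * x) * ((m' * k) * s) := by
      rw [hk.2.2, ← hm.2.1, hmx, hm'.2.2, hs.2.2, hk.2.2]

theorem coset_eq (hC : IsCLoop L) {a n : L} (hn : n ∈ nucleus L) :
    (fun m => (a * n) * m) '' nucleus L = (fun m => a * m) '' nucleus L := by
  ext z
  constructor
  · rintro ⟨m, hm, rfl⟩
    exact ⟨n * m, mul_mem_nucleus_s4 hn hm, hn.2.1 a m⟩
  · rintro ⟨m, hm, rfl⟩
    refine ⟨inv n * m, mul_mem_nucleus_s4 (hC.inv_mem_nucleus hn) hm, ?_⟩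
    simp only
    rw [← hn.2.1, hC.mul_inv_mul]

end IsCLoop

end Loop

/-- For a C-loop `L` with nucleus `N`, the quotient `L/N` is a Steiner loop:
all squares lie in `N`, and modulo `N` the multiplication is commutative
and satisfies `(y*x)*x = y`. -/
theorem statement4 {L : Type*} [Loop L]
    (hC : ∀ x y z : L, x * (y * (y * z)) = ((x * y) * y) * z) :
    (∀ x : L, x * x ∈ nucleus L) ∧
    (∀ x y : L,
      (fun n => (x * y) * n) '' nucleus L = (fun n => (y * x) * n) '' nucleus L) ∧
    (∀ x y : L,
      (fun n => ((y * x) * x) * n) '' nucleus L = (fun n => y * n) '' nucleus L) := by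
  have hC' : Loop.IsCLoop L := hC
  refine ⟨hC'.mul_self_mem_nucleus, fun x y => ?_, fun x y => ?_⟩
  · obtain ⟨n, hn, h⟩ := hC'.exists_mul_comm_mod_nucleus x y
    rw [h]
    exact hC'.coset_eq hn
  · rw [← hC'.mul_mul_self]
    exact hC'.coset_eq (hC'.mul_self_mem_nucleus x)
end

section
/- There is no C-loop whose nucleus has index 2: if L is a C-loop with nucleus N and there exists x ∈ L such that L = N ∪ x·N, then N = L (so L is a group). -/
/-- In a left alternative loop whose nucleus `N` satisfies `L = N ∪ x·N`, multiplication
is associative. -/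
theorem Loop.mul_assoc_of_left_alternative {L : Type*} [Loop L]
    (hleft : ∀ y z : L, y * (y * z) = (y * y) * z) {x : L}
    (hx : ∀ z : L, z ∈ nucleus L ∨ ∃ n ∈ nucleus L, z = x * n) (a b c : L) :
    (a * b) * c = a * (b * c) := by
  have key : ∀ b c : L, (x * b) * c = x * (b * c) := by
    intro b c
    rcases hx b with hb | ⟨m, hm, rfl⟩
    · exact (hb.2.1 x c).symm
    · rw [hleft x m, ← hm.2.1 (x * x) c, ← hleft x (m * c), hm.2.1 x c]
  rcases hx a with ha | ⟨n, hn, rfl⟩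
  · exact (ha.1 b c).symm
  · rw [← hn.2.1 x b, key (n * b) c, ← hn.1 b c, hn.2.1 x (b * c)]

/-- There is no C-loop whose nucleus has index 2: if `L = N ∪ x·N` for some `x`,
then the nucleus is everything, so `L` is a group. -/
theorem statement5 {L : Type*} [Loop L]
    (hC : ∀ x y z : L, x * (y * (y * z)) = ((x * y) * y) * z)
    (hidx : ∃ x : L, ∀ z : L, z ∈ nucleus L ∨ ∃ n ∈ nucleus L, z = x * n) :
    nucleus L = Set.univ ∧ ∀ x y z : L, (x * y) * z = x * (y * z) := by
  obtain ⟨x, hx⟩ := hidx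
  have hassoc := Loop.mul_assoc_of_left_alternative
    (fun y z : L => by simpa only [Loop.one_mul] using hC 1 y z) hx
  exact ⟨Set.eq_univ_of_forall fun a => ⟨fun y z => (hassoc a y z).symm,
    fun y z => (hassoc y a z).symm, fun y z => (hassoc y z a).symm⟩, hassoc⟩
end

section
/- Let L be a finite nonassociative C-loop of order n whose nucleus N has order m. Then n/m ≡ 2 (mod 6) or n/m ≡ 4 (mod 6); in particular, n is even. -/
/-- A binary operation `s` on a finite set satisfying the Steiner loop identities
(two-sided identity `e`, `x (x y) = y` and `(x y) y = x`) with more than one element lives on a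
set whose size is `2` or `4` modulo `6`. -/
theorem card_mod_six_of_steiner {Q : Type*} [Finite Q] (s : Q → Q → Q) (e : Q)
    (he : ∀ x, s e x = x) (hl : ∀ x y, s x (s x y) = y) (hr : ∀ x y, s (s x y) y = x)
    (hne : ∃ x, x ≠ e) : Nat.card Q % 6 = 2 ∨ Nat.card Q % 6 = 4 := by
  classical
  have := Fintype.ofFinite Q
  have fixes {x y : Q} (h : s x y = y) : x = e := by
    have h₁ := hr x y
    have h₂ := hr e y
    rw [h] at h₁
    rw [he] at h₂
    exact h₁.symm.trans h₂
  have flip (x y : Q) : s y (s x y) = x := by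
    have h := hr x (s x y)
    rwa [hl] at h
  have even : Nat.card Q ≡ 0 [MOD 2] := by
    obtain ⟨x, hx⟩ := hne
    let f : Function.End Q := s x
    have hf : f ^ 2 ^ 1 = 1 := by
      funext y
      exact hl x y
    have h := Equiv.Perm.card_fixedPoints_modEq (p := 2) (n := 1) hf
    have hempty : IsEmpty (Function.fixedPoints f) := ⟨fun y => hx (fixes y.2)⟩
    rwa [← Nat.card_eq_fintype_card, Fintype.card_eq_zero] at h
  have three : Nat.card Q * Nat.card Q ≡ 1 [MOD 3] := by
    let f : Function.End (Q × Q) := fun p => (p.2, s p.1 p.2)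
    have hf : f ^ 3 ^ 1 = 1 := by
      funext p
      change (s p.2 (s p.1 p.2), s (s p.1 p.2) (s p.2 (s p.1 p.2))) = p
      have h := flip p.2 (s p.1 p.2)
      rw [flip p.1 p.2] at h ⊢
      exact Prod.ext rfl h
    have h := Equiv.Perm.card_fixedPoints_modEq (p := 3) (n := 1) hf
    have hone : Fintype.card (Function.fixedPoints f) = 1 := by
      refine Fintype.card_eq_one_iff.2 ⟨⟨(e, e), Prod.ext rfl (he e)⟩, ?_⟩
      rintro ⟨⟨x, y⟩, hxy⟩
      have h₁ : y = x := congrArg Prod.fst hxy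
      have h₂ : s x y = y := congrArg Prod.snd hxy
      have h₃ := fixes h₂
      subst h₁ h₃
      rfl
    rwa [hone, Fintype.card_prod, ← Nat.card_eq_fintype_card] at h
  have h3 : Nat.card Q % 3 ≠ 0 := fun h => by
    have h₀ := Nat.mul_mod (Nat.card Q) (Nat.card Q) 3
    rw [h] at h₀
    unfold Nat.ModEq at three
    omega
  unfold Nat.ModEq at even
  omega

namespace Loop

variable {L : Type*} [Loop L]

theorem left_cancel {a b c : L} (h : a * b = a * c) : b = c :=
  (mulLeft_bijective a).injective h

/-- The inverse property: `i` assigns two-sided inverses that cancel on both sides. -/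
structure IsInverse (i : L → L) : Prop where
  cancel_left : ∀ x y : L, i x * (x * y) = y
  cancel_right : ∀ x y : L, (y * x) * i x = y

namespace IsInverse

variable {i : L → L} (hi : IsInverse i)
include hi

theorem inv_mul (x : L) : i x * x = 1 := by
  simpa only [mul_one] using hi.cancel_left x 1

theorem mul_inv (x : L) : x * i x = 1 := by
  simpa only [one_mul] using hi.cancel_right x 1

theorem inv_inv (x : L) : i (i x) = x :=
  left_cancel (a := i x) ((hi.mul_inv _).trans (hi.inv_mul _).symm)

theorem cancel_left' (x y : L) : x * (i x * y) = y := by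
  simpa only [hi.inv_inv] using hi.cancel_left (i x) y

theorem cancel_right' (x y : L) : (y * i x) * x = y := by
  simpa only [hi.inv_inv] using hi.cancel_right (i x) y

theorem inv_mul_rev (x y : L) : i (x * y) = i y * i x := by
  have h : i y = i (x * y) * x := by
    have h := hi.cancel_left (x * y) (i y)
    rw [hi.cancel_right] at h
    exact h.symm
  rw [h, hi.cancel_right]

/-- In an inverse property loop, inverses of middle nuclear elements are nuclear. -/
theorem inv_mem_nucleus {a : L} (ha : ∀ x y : L, x * (a * y) = (x * a) * y) :
    i a ∈ nucleus L := by
  refine ⟨fun x w => ?_, fun x y => ?_, fun w y => ?_⟩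
  · have h := ha (i x) (i a * (x * w))
    rw [hi.cancel_left', hi.cancel_left] at h
    have h₀ := hi.cancel_left (i x * a) (i a * (x * w))
    rw [← h, hi.inv_mul_rev, hi.inv_inv] at h₀
    exact h₀.symm
  · have h := congrArg i (ha (i y) (i x))
    simpa only [hi.inv_mul_rev, hi.inv_inv] using h.symm
  · have h := ha ((w * y) * i a) (i y)
    rw [hi.cancel_right', hi.cancel_right] at h
    have h₀ := hi.cancel_right (a * i y) ((w * y) * i a)
    rw [h, hi.inv_mul_rev, hi.inv_inv] at h₀
    exact h₀

/-- In an inverse property loop, middle nuclear elements are nuclear. -/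
theorem mem_nucleus {a : L} (ha : ∀ x y : L, x * (a * y) = (x * a) * y) : a ∈ nucleus L := by
  simpa only [hi.inv_inv] using hi.inv_mem_nucleus (hi.inv_mem_nucleus ha).2.1

theorem mul_mem_nucleus {a b : L} (ha : a ∈ nucleus L) (hb : b ∈ nucleus L) :
    a * b ∈ nucleus L :=
  hi.mem_nucleus fun x y => by
    rw [← ha.1, ha.2.1, hb.2.1, ← ha.2.1 x b]

end IsInverse

section CLoop

variable (hC : ∀ x y z : L, x * (y * (y * z)) = ((x * y) * y) * z)
include hC

theorem left_alternative (y z : L) : y * (y * z) = (y * y) * z := by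
  simpa only [one_mul] using hC 1 y z

theorem right_alternative (x y : L) : x * (y * y) = (x * y) * y := by
  simpa only [mul_one] using hC x y 1

/-- C-loops have the inverse property. -/
theorem exists_isInverse : ∃ i : L → L, IsInverse i := by
  choose i hi using fun y : L => (mulRight_bijective y).surjective 1
  replace hi : ∀ y, i y * y = 1 := hi
  have hl (y w : L) : i y * (y * w) = w := by
    obtain ⟨z, rfl⟩ := (mulLeft_bijective y).surjective w
    simp only [hC, hi, one_mul]
  refine ⟨i, hl, fun y w => ?_⟩
  obtain ⟨x, rfl⟩ := (mulRight_bijective y).surjective w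
  have hr : y * i y = 1 := left_cancel (a := i y) (by rw [hl, mul_one])
  simp only [← hC, hr, mul_one]

theorem sq_mem_nucleus (x : L) : x * x ∈ nucleus L := by
  obtain ⟨i, hi⟩ := exists_isInverse hC
  refine hi.mem_nucleus fun u v => ?_
  rw [← left_alternative hC, hC, right_alternative hC]

/-- The nucleus of a C-loop is closed under conjugation. -/
theorem exists_mem_nucleus_mul_eq {a : L} (ha : a ∈ nucleus L) (b : L) :
    ∃ c ∈ nucleus L, a * b = b * c := by
  obtain ⟨i, hi⟩ := exists_isInverse hC
  have hbab : (b * a) * b ∈ nucleus L := by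
    have h := hi.mul_mem_nucleus (sq_mem_nucleus hC (b * a)) (hi.inv_mem_nucleus ha.2.1)
    rwa [ha.2.2, hi.cancel_right] at h
  refine ⟨i (b * b) * ((b * a) * b),
    hi.mul_mem_nucleus (hi.inv_mem_nucleus (sq_mem_nucleus hC b).2.1) hbab, ?_⟩
  refine left_cancel (a := b) ?_
  rw [left_alternative hC, hi.cancel_left', ha.2.1]

/-- The partition of a C-loop into cosets of its nucleus. -/
theorem equivalence_nucleus : Equivalence fun x y : L => ∃ a ∈ nucleus L, y = x * a := by
  obtain ⟨i, hi⟩ := exists_isInverse hC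
  refine ⟨fun x => ⟨1, ?_, (mul_one x).symm⟩, ?_, ?_⟩
  · simpa only [one_mul] using sq_mem_nucleus hC (1 : L)
  · rintro x _ ⟨a, ha, rfl⟩
    exact ⟨i a, hi.inv_mem_nucleus ha.2.1, (hi.cancel_right a x).symm⟩
  · rintro x _ _ ⟨a, ha, rfl⟩ ⟨b, hb, rfl⟩
    exact ⟨a * b, hi.mul_mem_nucleus ha hb, (ha.2.1 x b).symm⟩

/-- Multiplication in a C-loop respects cosets of the nucleus. -/
theorem exists_mem_nucleus_mul_mul_eq (x y : L) {a b : L} (ha : a ∈ nucleus L)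
    (hb : b ∈ nucleus L) : ∃ c ∈ nucleus L, (x * a) * (y * b) = (x * y) * c := by
  obtain ⟨i, hi⟩ := exists_isInverse hC
  obtain ⟨c, hc, h⟩ := exists_mem_nucleus_mul_eq hC ha y
  exact ⟨c * b, hi.mul_mem_nucleus hc hb, by
    rw [← ha.2.1, ha.1, h, hb.2.2, hc.2.2, hc.2.1]⟩

end CLoop

end Loop

/-- For a finite nonassociative C-loop of order `n` whose nucleus has order `m`,
the index `n/m` is congruent to 2 or 4 mod 6; in particular `n` is even. -/
theorem statement6 {L : Type*} [Loop L] [Finite L]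
    (hC : ∀ x y z : L, x * (y * (y * z)) = ((x * y) * y) * z)
    (hna : ∃ x y z : L, (x * y) * z ≠ x * (y * z)) :
    (∃ q : ℕ, Nat.card L = Nat.card (nucleus L) * q ∧ (q % 6 = 2 ∨ q % 6 = 4)) ∧
    Even (Nat.card L) := by
  obtain ⟨i, hi⟩ := Loop.exists_isInverse hC
  let S : Setoid L := ⟨_, Loop.equivalence_nucleus hC⟩
  let s : Quotient S → Quotient S → Quotient S := Quotient.map₂ (· * ·) (by
    rintro x _ ⟨a, ha, rfl⟩ y _ ⟨b, hb, rfl⟩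
    exact Loop.exists_mem_nucleus_mul_mul_eq hC x y ha hb)
  have hq : Nat.card (Quotient S) % 6 = 2 ∨ Nat.card (Quotient S) % 6 = 4 := by
    refine card_mod_six_of_steiner s ⟦1⟧ ?_ ?_ ?_ ?_
    · rintro ⟨x⟩
      exact congrArg (Quotient.mk S) (Loop.one_mul x)
    · rintro ⟨x⟩ ⟨y⟩
      obtain ⟨c, hc, h⟩ := Loop.exists_mem_nucleus_mul_eq hC (Loop.sq_mem_nucleus hC x) y
      refine (Quotient.sound (s := S) ⟨c, hc, ?_⟩).symm
      rw [← h, ← Loop.left_alternative hC]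
    · rintro ⟨x⟩ ⟨y⟩
      exact (Quotient.sound (s := S)
        ⟨y * y, Loop.sq_mem_nucleus hC y, (Loop.right_alternative hC x y).symm⟩).symm
    · by_contra! hall
      obtain ⟨x, y, z, hxyz⟩ := hna
      obtain ⟨a, ha, rfl⟩ : ∃ a ∈ nucleus L, x = 1 * a :=
        Quotient.exact (s := S) (hall ⟦x⟧).symm
      rw [Loop.one_mul] at hxyz
      exact hxyz (ha.1 y z).symm
  have hcard : Nat.card L = Nat.card (nucleus L) * Nat.card (Quotient S) := by
    rw [← Nat.card_prod]
    refine (Nat.card_eq_of_bijective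
      (fun p : nucleus L × Quotient S => p.2.out * (p.1 : L)) ⟨?_, fun x => ?_⟩).symm
    · rintro ⟨⟨a, ha⟩, p⟩ ⟨⟨b, hb⟩, q⟩ h
      replace h : p.out * a = q.out * b := h
      have hp : (⟦p.out⟧ : Quotient S) = ⟦p.out * a⟧ := Quotient.sound (s := S) ⟨a, ha, rfl⟩
      have hq : (⟦q.out⟧ : Quotient S) = ⟦q.out * b⟧ := Quotient.sound (s := S) ⟨b, hb, rfl⟩
      rw [h, ← hq, Quotient.out_eq, Quotient.out_eq] at hp
      subst hp
      obtain rfl := Loop.left_cancel h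
      rfl
    · obtain ⟨a, ha, h⟩ : ∃ a ∈ nucleus L, x = (⟦x⟧ : Quotient S).out * a :=
        Quotient.mk_out (s := S) x
      exact ⟨(⟨a, ha⟩, ⟦x⟧), h.symm⟩
  refine ⟨⟨_, hcard, hq⟩, ?_⟩
  rw [hcard]
  exact Even.mul_left (Nat.even_iff.2 (by omega)) _
end

section
/- Let L be a nonassociative C-loop whose order is a prime power p^k (p prime, k ≥ 1). Then p = 2 and k > 3; that is, every C-loop of order p^k with p odd, and every C-loop of order 2, 4 or 8, is a group. -/
namespace CLoop

variable {L : Type*} [Loop L]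

theorem mul_left_cancel {a b c : L} (h : a * b = a * c) : b = c :=
  (Loop.mulLeft_bijective a).1 h

theorem mul_right_cancel {a b c : L} (h : b * a = c * a) : b = c :=
  (Loop.mulRight_bijective a).1 h

/-- The right inverse of an element of a loop. -/
noncomputable def inv (a : L) : L := ((Loop.mulLeft_bijective a).2 1).choose

theorem mul_inv (a : L) : a * inv a = 1 := ((Loop.mulLeft_bijective a).2 1).choose_spec

/-- Left translation as a permutation. -/
noncomputable def lmul (a : L) : Equiv.Perm L := Equiv.ofBijective _ (Loop.mulLeft_bijective a)

@[simp] theorem lmul_apply (a b : L) : lmul a b = a * b := rfl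

/-- Membership in the nucleus: the element associates with all pairs, in every position. -/
structure IsNuclear (m : L) : Prop where
  left : ∀ x y : L, m * x * y = m * (x * y)
  middle : ∀ x y : L, x * m * y = x * (m * y)
  right : ∀ x y : L, x * y * m = x * (y * m)

theorem isNuclear_one : IsNuclear (1 : L) := by
  constructor <;> simp [Loop.one_mul, Loop.mul_one]

theorem IsNuclear.mul {m n : L} (hm : IsNuclear m) (hn : IsNuclear n) : IsNuclear (m * n) where
  left x y := by rw [hm.left, hm.left, hn.left, ← hm.left]
  middle x y := by rw [← hm.middle, hn.middle, hm.middle, ← hm.left]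
  right x y := by rw [← hn.right, hm.right, hn.right, hn.right]

/-- The C-loop identity. -/
def IsC (L : Type*) [Loop L] : Prop := ∀ x y z : L, x * (y * (y * z)) = ((x * y) * y) * z

/-- Every element of a nucleus with at most two elements squares to the identity. -/
theorem IsNuclear.mul_self_of_card_le_two
    (H : ∀ a b c : L, IsNuclear a → IsNuclear b → IsNuclear c → a = b ∨ a = c ∨ b = c)
    {n : L} (hn : IsNuclear n) : n * n = 1 := by
  rcases H (n * n) n 1 (hn.mul hn) hn isNuclear_one with h | h | h
  · rw [h, mul_left_cancel (h.trans (Loop.mul_one n).symm)]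
  · exact h
  · rw [h, Loop.mul_one]

theorem right_alt (hC : IsC L) (x y : L) : x * y * y = x * (y * y) := by
  have := hC x y 1
  simpa [Loop.mul_one] using this.symm

theorem left_alt (hC : IsC L) (x y : L) : x * x * y = x * (x * y) := by
  have := hC 1 x y
  simpa [Loop.one_mul] using this.symm

theorem mul_inv_cancel_right (hC : IsC L) (x y : L) : x * y * inv y = x := by
  obtain ⟨w, rfl⟩ := (Loop.mulRight_bijective y).2 x
  have := hC w y (inv y)
  rw [mul_inv, Loop.mul_one] at this
  exact this.symm

theorem inv_mul (hC : IsC L) (x : L) : inv x * x = 1 := by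
  obtain ⟨w, hw⟩ := (Loop.mulRight_bijective x).2 1
  have h := mul_inv_cancel_right hC w x
  simp only at hw
  rw [hw, Loop.one_mul] at h
  rw [h, hw]

theorem inv_mul_cancel_left (hC : IsC L) (x y : L) : inv x * (x * y) = y := by
  obtain ⟨w, rfl⟩ := (Loop.mulLeft_bijective x).2 y
  have := hC (inv x) x w
  rwa [inv_mul hC, Loop.one_mul] at this

theorem inv_inv (hC : IsC L) (x : L) : inv (inv x) = x := by
  apply mul_left_cancel (a := inv x)
  rw [mul_inv, inv_mul hC]

theorem mul_inv_cancel_left (hC : IsC L) (x y : L) : x * (inv x * y) = y := by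
  have := inv_mul_cancel_left hC (inv x) y
  rwa [inv_inv hC] at this

theorem inv_mul_cancel_right (hC : IsC L) (x y : L) : x * inv y * y = x := by
  have := mul_inv_cancel_right hC x (inv y)
  rwa [inv_inv hC] at this

theorem mul_inv_rev (hC : IsC L) (x y : L) : inv (x * y) = inv y * inv x := by
  have h := inv_mul_cancel_left hC (x * y) (inv y)
  rw [mul_inv_cancel_right hC] at h
  rw [← h, mul_inv_cancel_right hC]

theorem isNuclear_of_middle (hC : IsC L) {m : L} (h : ∀ x y : L, x * m * y = x * (m * y)) :
    IsNuclear m where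
  middle := h
  left x y := by
    have e := h (inv (m * x)) (x * y)
    rw [mul_inv_rev hC, inv_mul_cancel_right hC, inv_mul_cancel_left hC, ← mul_inv_rev hC] at e
    rw [e, mul_inv_cancel_left hC, ← e]
  right x y := by
    have e := h (x * y) (inv (y * m))
    rw [mul_inv_rev hC, mul_inv_cancel_left hC, mul_inv_cancel_right hC, ← mul_inv_rev hC] at e
    rw [← inv_mul_cancel_right hC (x * y * m) (y * m), e]

theorem isNuclear_mul_self (hC : IsC L) (x : L) : IsNuclear (x * x) :=
  isNuclear_of_middle hC fun a b => by
    rw [left_alt hC, hC, right_alt hC]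

theorem IsNuclear.inv (hC : IsC L) {m : L} (hm : IsNuclear m) : IsNuclear (inv m) :=
  isNuclear_of_middle hC fun x y => by
    have := hm.middle (x * CLoop.inv m) (CLoop.inv m * y)
    rw [inv_mul_cancel_right hC, mul_inv_cancel_left hC] at this
    exact this.symm

theorem exists_lmul_pow_two_mul (hC : IsC L) (x : L) (k : ℕ) :
    ∃ n : L, IsNuclear n ∧ lmul x ^ (2 * k) = lmul n := by
  induction k with
  | zero => exact ⟨1, isNuclear_one, by ext; simp [Loop.one_mul]⟩
  | succ k ih =>
    obtain ⟨n, hn, h⟩ := ih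
    refine ⟨n * (x * x), hn.mul (isNuclear_mul_self hC x), ?_⟩
    rw [mul_add, pow_add, h]
    ext z
    simp [pow_two, hn.left, left_alt hC]

theorem exists_lmul_pow (hC : IsC L) (x : L) (k : ℕ) : ∃ u : L, lmul x ^ k = lmul u := by
  obtain ⟨j, rfl | rfl⟩ := Nat.even_or_odd' k
  · obtain ⟨n, -, h⟩ := exists_lmul_pow_two_mul hC x j
    exact ⟨n, h⟩
  · obtain ⟨n, hn, h⟩ := exists_lmul_pow_two_mul hC x j
    refine ⟨n * x, ?_⟩
    rw [pow_succ, h]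
    ext z
    simp [hn.left]

theorem isNuclear_of_odd (hC : IsC L) [Finite L] (hodd : Odd (Nat.card L)) (x : L) :
    IsNuclear x := by
  classical
  have := Fintype.ofFinite L
  obtain ⟨j, h | h⟩ := Nat.even_or_odd' (orderOf (lmul x))
  · exfalso
    obtain ⟨u, hu⟩ := exists_lmul_pow hC x j
    have hpos : 0 < orderOf (lmul x) := orderOf_pos _
    have hne : lmul u ≠ 1 := by
      rw [← hu]
      exact pow_ne_one_of_lt_orderOf (by lia) (by lia)
    have hsq : lmul u ^ 2 = 1 := by
      rw [← hu, ← pow_mul, mul_comm, ← h, pow_orderOf_eq_one]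
    have hsupp : (lmul u).support = Finset.univ := by
      ext z
      simp only [Equiv.Perm.mem_support, lmul_apply, Finset.mem_univ, iff_true]
      intro hz
      have hu1 : u = 1 := mul_right_cancel (hz.trans (Loop.one_mul z).symm)
      exact hne (by ext w; simp [hu1, Loop.one_mul])
    have h2 := Equiv.Perm.two_dvd_card_support hsq
    rw [hsupp, Finset.card_univ, ← Nat.card_eq_fintype_card] at h2
    exact (Nat.not_even_iff_odd.2 hodd) (even_iff_two_dvd.2 h2)
  · obtain ⟨n, hn, hx⟩ := exists_lmul_pow_two_mul hC x (j + 1)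
    have e : 2 * (j + 1) = orderOf (lmul x) + 1 := by lia
    rw [e, pow_succ, pow_orderOf_eq_one, one_mul] at hx
    have := congrArg (fun σ : Equiv.Perm L => σ 1) hx
    simp only [lmul_apply, Loop.mul_one] at this
    rwa [this]

theorem length_mul_card_le (hC : IsC L) [Finite L] (l : List L)
    (hl : l.Pairwise fun a b => ∀ n, IsNuclear n → b ≠ a * n) :
    l.length * Nat.card {n : L // IsNuclear n} ≤ Nat.card L := by
  have key : Function.Injective
      fun q : Fin l.length × {n : L // IsNuclear n} => l.get q.1 * q.2.1 := by
    rintro ⟨i, m, hm⟩ ⟨j, n, hn⟩ h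
    simp only at h
    have h1 : l.get i = l.get j * (n * inv m) := by
      rw [← hn.middle] at *
      rw [← h, mul_inv_cancel_right hC]
    have h2 : l.get j = l.get i * (m * inv n) := by
      rw [← hm.middle] at *
      rw [h, mul_inv_cancel_right hC]
    rw [List.pairwise_iff_get] at hl
    rcases lt_trichotomy i j with hij | rfl | hij
    · exact (hl i j hij _ (hm.mul (hn.inv hC)) h2).elim
    · simp only [Prod.mk.injEq, Subtype.mk.injEq, true_and]
      exact mul_left_cancel h
    · exact (hl j i hij _ (hn.mul (hm.inv hC)) h1).elim
  simpa using Nat.card_le_card_of_injective _ key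

/-- A nucleus with at most two elements is central. -/
theorem IsNuclear.comm_of_card_le_two (hC : IsC L)
    (H : ∀ a b c : L, IsNuclear a → IsNuclear b → IsNuclear c → a = b ∨ a = c ∨ b = c)
    {n : L} (hn : IsNuclear n) (x : L) : x * n = n * x := by
  by_cases h1 : n = 1
  · rw [h1, Loop.mul_one, Loop.one_mul]
  have hnn := hn.mul_self_of_card_le_two H
  have hp : IsNuclear (x * (n * (x * n))) := by
    have := isNuclear_mul_self hC (x * n)
    rwa [hn.middle] at this
  have hq := isNuclear_mul_self hC x
  rcases H _ _ _ hp hq (hq.mul hn) with h | h | h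
  · have := mul_left_cancel h
    have e : n * (n * (x * n)) = n * x := by rw [this]
    rwa [← hn.left, hnn, Loop.one_mul] at e
  · rw [hn.right] at h
    have := mul_left_cancel h
    exact (h1 (mul_right_cancel (this.trans (Loop.one_mul _).symm))).elim
  · exact (h1 (mul_left_cancel (h.symm.trans (Loop.mul_one _).symm))).elim

theorem exists_eq_inv_mul (hC : IsC L) (u : L) : ∃ n, IsNuclear n ∧ u = inv u * n :=
  ⟨u * u, isNuclear_mul_self hC u, (inv_mul_cancel_left hC u u).symm⟩

/-- If the nucleus is central, then a C-loop is commutative up to the nucleus. -/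
theorem exists_mul_comm (hC : IsC L) (hcen : ∀ n x : L, IsNuclear n → x * n = n * x) (x y : L) :
    ∃ n, IsNuclear n ∧ y * x = x * y * n := by
  obtain ⟨a, ha, hax⟩ := exists_eq_inv_mul hC (inv x)
  obtain ⟨b, hb, hby⟩ := exists_eq_inv_mul hC (inv y)
  obtain ⟨c, hc, hcyx⟩ := exists_eq_inv_mul hC (y * x)
  rw [inv_inv hC] at hax hby
  refine ⟨a * b * c, (ha.mul hb).mul hc, ?_⟩
  rw [hcyx, mul_inv_rev hC, hax, hby, ha.middle, ← ha.left, ← hcen a y ha, ha.middle,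
    ← (ha.mul hb).right, hc.right]

/-- A C-loop whose nucleus is central of exponent two is flexible. -/
theorem flexible (hC : IsC L) (hcen : ∀ n x : L, IsNuclear n → x * n = n * x)
    (hexp : ∀ n : L, IsNuclear n → n * n = 1) (x y : L) : x * y * x = x * (y * x) := by
  obtain ⟨n, hn, h⟩ := exists_mul_comm hC hcen x y
  have h' : x * y = y * x * n := by rw [h, hn.right, hexp n hn, Loop.mul_one]
  rw [h, ← hn.right, ← left_alt hC, h', hn.middle, ← hcen n x hn, ← hn.right, right_alt hC,
    hcen _ y (isNuclear_mul_self hC x)]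

theorem assoc_of_mul_nuclear (hC : IsC L) {x y z n : L} (hn : IsNuclear n) (h : x * y = n) :
    x * y * z = x * (y * z) := by
  have hy : y = inv x * n := by rw [← h, inv_mul_cancel_left hC]
  rw [h, hy, hn.middle, mul_inv_cancel_left hC]

theorem assoc_of_eq_mul (hC : IsC L) {x y z n : L} (hn : IsNuclear n) (h : z = y * n) :
    x * y * z = x * (y * z) := by
  rw [h, hC, hn.right]

theorem assoc_of_eq_inv_mul (hC : IsC L) {x y z n : L} (hn : IsNuclear n)
    (h : z = inv (x * y) * n) :
    x * y * z = x * (y * z) := by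
  rw [h, mul_inv_cancel_left hC, mul_inv_rev hC, hn.right, mul_inv_cancel_left hC,
    mul_inv_cancel_left hC]

/-- In a nonassociating triple of a C-loop, `1, y, (x * y)⁻¹, z` lie in distinct cosets of the
nucleus. -/
theorem four_mul_card_le (hC : IsC L) [Finite L] {x y z : L} (h : x * y * z ≠ x * (y * z)) :
    4 * Nat.card {n : L // IsNuclear n} ≤ Nat.card L := by
  refine length_mul_card_le hC [1, y, inv (x * y), z] ?_
  simp only [List.pairwise_cons, List.mem_cons, List.not_mem_nil, or_false, forall_eq_or_imp,
    forall_eq, Loop.one_mul]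
  refine ⟨⟨?_, ?_, ?_⟩, ⟨?_, ?_⟩, ?_, ?_⟩
  · rintro n hn rfl; exact h (hn.middle _ _)
  · intro n hn e
    exact h (assoc_of_mul_nuclear hC (hn.inv hC) (by rw [← e, inv_inv hC]))
  · rintro n hn rfl; exact h (hn.right _ _)
  · intro n hn e
    have e' : x = inv n * (inv y * inv y) := by
      rw [← (hn.inv hC).left, ← mul_inv_rev hC, ← e, inv_inv hC, mul_inv_cancel_right hC]
    have hx : IsNuclear x := e' ▸ (hn.inv hC).mul (isNuclear_mul_self hC _)
    exact h (hx.left _ _)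
  · intro n hn e; exact h (assoc_of_eq_mul hC hn e)
  · intro n hn e; exact h (assoc_of_eq_inv_mul hC hn e)
  · simp

/-- If the nucleus is moreover central of exponent two, then `1, x, y, x * y, z` lie in distinct
cosets of the nucleus. -/
theorem five_mul_card_le (hC : IsC L) [Finite L]
    (hcen : ∀ n x : L, IsNuclear n → x * n = n * x)
    (hexp : ∀ n : L, IsNuclear n → n * n = 1) {x y z : L} (h : x * y * z ≠ x * (y * z)) :
    5 * Nat.card {n : L // IsNuclear n} ≤ Nat.card L := by
  refine length_mul_card_le hC [1, x, y, x * y, z] ?_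
  simp only [List.pairwise_cons, List.mem_cons, List.not_mem_nil, or_false, forall_eq_or_imp,
    forall_eq, Loop.one_mul]
  refine ⟨⟨?_, ?_, ?_, ?_⟩, ⟨?_, ?_, ?_⟩, ⟨?_, ?_⟩, ?_, ?_⟩
  · rintro n hn rfl; exact h (hn.left _ _)
  · rintro n hn rfl; exact h (hn.middle _ _)
  · intro n hn e; exact h (assoc_of_mul_nuclear hC hn e)
  · rintro n hn rfl; exact h (hn.right _ _)
  · rintro n hn rfl
    exact h (by rw [← hn.right, hn.middle, hn.middle, left_alt hC])
  · intro n hn e; exact h ((mul_left_cancel e ▸ hn).middle _ _)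
  · rintro n hn rfl
    exact h (by rw [← hn.right, ← hn.right, ← hn.right, flexible hC hcen hexp])
  · intro n hn e
    obtain ⟨c, hc, e'⟩ := exists_mul_comm hC hcen x y
    rw [e, hc.right] at e'
    exact h ((mul_left_cancel e' ▸ hn.mul hc : IsNuclear x).left _ _)
  · intro n hn e; exact h (assoc_of_eq_mul hC hn e)
  · intro n hn e
    obtain ⟨c, hc, e'⟩ := exists_eq_inv_mul hC (x * y)
    exact h (assoc_of_eq_inv_mul hC (hc.mul hn) (by rw [← hn.right, ← e', e]))
  · simp

/-- A nonassociative Steiner loop has at least nine elements. -/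
theorem nine_le_card_of_sq_eq_one (hC : IsC L) [Finite L] (hsq : ∀ x : L, x * x = 1) {x y z : L}
    (h : x * y * z ≠ x * (y * z)) : 9 ≤ Nat.card L := by
  have hinv : ∀ a : L, inv a = a := fun a =>
    mul_left_cancel ((mul_inv a).trans (hsq a).symm)
  have hcomm : ∀ a b : L, a * b = b * a := fun a b => by
    have := mul_inv_rev hC a b
    rwa [hinv, hinv, hinv] at this
  have hll : ∀ a b : L, a * (a * b) = b := fun a b => by
    rw [← left_alt hC, hsq, Loop.one_mul]
  have := Fintype.ofFinite L
  rw [Nat.card_eq_fintype_card]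
  have nd : [1, x, y, x * y, z, x * z, y * z, x * y * z, x * (y * z)].Nodup := by
    have h1l := Loop.one_mul (L := L)
    have h1r := Loop.mul_one (L := L)
    have hlc := @mul_left_cancel L _
    simp only [List.nodup_cons, List.mem_cons, List.not_mem_nil, or_false, not_or, List.nodup_nil,
      and_true, not_false_eq_true]
    refine ⟨⟨?_, ?_, ?_, ?_, ?_, ?_, ?_, ?_⟩, ⟨?_, ?_, ?_, ?_, ?_, ?_, ?_⟩,
      ⟨?_, ?_, ?_, ?_, ?_, ?_⟩, ⟨?_, ?_, ?_, ?_, ?_⟩, ⟨?_, ?_, ?_, ?_⟩, ⟨?_, ?_, ?_⟩, ⟨?_, ?_⟩, ?_⟩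
    all_goals grind
  exact nd.length_le_card

theorem nine_le_card (hC : IsC L) [Finite L] {x y z : L} (h : x * y * z ≠ x * (y * z)) :
    9 ≤ Nat.card L := by
  classical
  have := Fintype.ofFinite L
  by_cases H : ∀ a b c : L, IsNuclear a → IsNuclear b → IsNuclear c → a = b ∨ a = c ∨ b = c
  · have h5 := five_mul_card_le hC (fun n x hn => hn.comm_of_card_le_two hC H x)
      (fun n hn => hn.mul_self_of_card_le_two H) h
    by_cases hsq : ∀ x : L, x * x = 1
    · exact nine_le_card_of_sq_eq_one hC hsq h
    · push Not at hsq
      obtain ⟨a, ha⟩ := hsq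
      have : Nontrivial {n : L // IsNuclear n} :=
        ⟨⟨a * a, isNuclear_mul_self hC a⟩, ⟨1, isNuclear_one⟩, by simpa [Subtype.ext_iff] using ha⟩
      have := Finite.one_lt_card (α := {n : L // IsNuclear n})
      lia
  · push Not at H
    obtain ⟨a, b, c, ha, hb, hc, hab, hac, hbc⟩ := H
    have h4 := four_mul_card_le hC h
    have : 2 < Nat.card {n : L // IsNuclear n} := by
      rw [Nat.card_eq_fintype_card, Fintype.two_lt_card_iff]
      exact ⟨⟨a, ha⟩, ⟨b, hb⟩, ⟨c, hc⟩, by simpa using hab, by simpa using hac, by simpa using hbc⟩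
    lia

end CLoop

/-- A nonassociative C-loop of prime power order `p^k` must have `p = 2` and `k > 3`;
equivalently, every C-loop of odd prime power order and every C-loop of order
2, 4 or 8 is associative. -/
theorem statement7 {L : Type*} [Loop L] [Finite L]
    (hC : ∀ x y z : L, x * (y * (y * z)) = ((x * y) * y) * z)
    (hna : ∃ x y z : L, (x * y) * z ≠ x * (y * z))
    (p k : ℕ) (hp : p.Prime) (hk : 1 ≤ k) (hcard : Nat.card L = p ^ k) :
    p = 2 ∧ 3 < k := by
  obtain ⟨x, y, z, h⟩ := hna
  have hp2 : p = 2 := by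
    by_contra hne
    have hodd : Odd (Nat.card L) := hcard ▸ (hp.odd_of_ne_two hne).pow
    exact h ((CLoop.isNuclear_of_odd hC hodd x).left y z)
  refine ⟨hp2, ?_⟩
  by_contra hk3
  have h9 := CLoop.nine_le_card hC h
  have : p ^ k ≤ 2 ^ 3 := hp2 ▸ Nat.pow_le_pow_right (by lia) (by lia)
  lia
end

section
/- Let G be a group with neutral element 1, A an abelian group (written additively) with neutral element 0, and μ : G × G → A a factor set, i.e., μ(1,g) = μ(g,1) = 0 for all g ∈ G. Define a multiplication on G × A by (g,a)·(h,b) = (g·h, a + b + μ(g,h)). Then G × A with this multiplication is a loop with neutral element (1,0), and it is a C-loop if and only if μ(h,k) + μ(h,h·k) + μ(g, h·(h·k)) = μ(g,h) + μ(g·h, h) + μ((g·h)·h, k) for all g, h, k ∈ G. -/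
/-- Multiplication on `G × A` determined by a factor set `μ : G × G → A`:
`(g,a)·(h,b) = (g·h, a + b + μ(g,h))`. -/
def cMul {G A : Type*} [Group G] [AddCommGroup A] (μ : G → G → A)
    (p q : G × A) : G × A :=
  (p.1 * q.1, p.2 + q.2 + μ p.1 q.1)

/-- If `μ` is a factor set, then `G × A` with the multiplication
`(g,a)·(h,b) = (gh, a+b+μ(g,h))` is a loop with neutral element `(1,0)`, and it
is a C-loop if and only if `μ` satisfies the C-factor-set equation. -/
theorem statement8 {G A : Type*} [Group G] [AddCommGroup A] (μ : G → G → A)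
    (h1 : ∀ g : G, μ 1 g = 0) (h2 : ∀ g : G, μ g 1 = 0) :
    (∀ p : G × A, cMul μ (1, 0) p = p) ∧
    (∀ p : G × A, cMul μ p (1, 0) = p) ∧
    (∀ p : G × A, Function.Bijective (cMul μ p)) ∧
    (∀ p : G × A, Function.Bijective fun q => cMul μ q p) ∧
    ((∀ p q r : G × A, cMul μ p (cMul μ q (cMul μ q r)) = cMul μ (cMul μ (cMul μ p q) q) r) ↔
      ∀ g h k : G,
        μ h k + μ h (h * k) + μ g (h * (h * k)) =
          μ g h + μ (g * h) h + μ ((g * h) * h) k) := by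
  refine ⟨fun p => ?_, fun p => ?_, fun p => ⟨fun q r hqr => ?_, fun q => ?_⟩,
    fun p => ⟨fun q r hqr => ?_, fun q => ?_⟩, fun hC g h k => ?_, fun hμ p q r => ?_⟩
  · simp [cMul, h1]
  · simp [cMul, h2]
  · obtain ⟨hfst, hsnd⟩ := Prod.ext_iff.mp hqr
    have hG : q.1 = r.1 := mul_left_cancel hfst
    simp only [cMul, hG] at hsnd
    exact Prod.ext hG (add_left_cancel (add_right_cancel hsnd))
  · refine ⟨(p.1⁻¹ * q.1, q.2 - p.2 - μ p.1 (p.1⁻¹ * q.1)), Prod.ext ?_ ?_⟩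
    · simp [cMul]
    · simp only [cMul]
      abel
  · obtain ⟨hfst, hsnd⟩ := Prod.ext_iff.mp hqr
    have hG : q.1 = r.1 := mul_right_cancel hfst
    simp only [cMul, hG] at hsnd
    exact Prod.ext hG (add_right_cancel (add_right_cancel hsnd))
  · refine ⟨(q.1 * p.1⁻¹, q.2 - p.2 - μ (q.1 * p.1⁻¹) p.1), Prod.ext ?_ ?_⟩
    · simp [cMul]
    · simp only [cMul]
      abel
  · simpa only [cMul, zero_add, add_zero] using congrArg Prod.snd (hC (g, 0) (h, 0) (k, 0))
  · refine Prod.ext ?_ ?_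
    · simp only [cMul, mul_assoc]
    · simp only [cMul]
      calc
        _ = p.2 + q.2 + q.2 + r.2 + (μ q.1 r.1 + μ q.1 (q.1 * r.1) +
              μ p.1 (q.1 * (q.1 * r.1))) := by abel
        _ = p.2 + q.2 + q.2 + r.2 + (μ p.1 q.1 + μ (p.1 * q.1) q.1 +
              μ (p.1 * q.1 * q.1) r.1) := by rw [hμ]
        _ = _ := by abel
end

section
/- Let A be an abelian group (written additively) containing an element α of order greater than 2, and let G = {1, u, v, w} be the Klein four-group with neutral element 1. Define μ : G × G → A by μ(v,w) = μ(w,u) = μ(w,w) = α, μ(v,u) = −α, and μ(x,y) = 0 otherwise. Then G × A with multiplication (g,a)·(h,b) = (g·h, a + b + μ(g,h)) is a C-loop that is noncommutative and non-flexible (hence nonassociative), and its nucleus is exactly {(1,a) : a ∈ A}. -/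
/-- The Klein four-group. -/
abbrev Klein : Type := Multiplicative (ZMod 2 × ZMod 2)

def uK : Klein := Multiplicative.ofAdd (1, 0)
def vK : Klein := Multiplicative.ofAdd (0, 1)
def wK : Klein := Multiplicative.ofAdd (1, 1)

/-- The C-factor set of Proposition 3.6: `μ(v,w) = μ(w,u) = μ(w,w) = α`,
`μ(v,u) = -α`, and `μ(x,y) = 0` otherwise. -/
def kleinMu {A : Type*} [AddCommGroup A] (α : A) (x y : Klein) : A :=
  if (x, y) = (vK, wK) ∨ (x, y) = (wK, uK) ∨ (x, y) = (wK, wK) then α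
  else if (x, y) = (vK, uK) then -α
  else 0

/-- Every value of the factor set is the multiple of `α` given by the integer factor set. -/
lemma kleinMu_eq_zsmul {A : Type*} [AddCommGroup A] (α : A) (x y : Klein) :
    kleinMu α x y = kleinMu (1 : ℤ) x y • α := by
  unfold kleinMu
  split_ifs <;> simp

lemma zsmul_ne_zero_of_add_self_ne_zero {A : Type*} [AddCommGroup A] {α : A} (hα : α + α ≠ 0)
    {n : ℤ} (hn : n ∈ [1, -1, 2, -2]) : n • α ≠ 0 := by
  have h : α ≠ 0 := fun h => hα (by simp [h])
  simp only [List.mem_cons, List.not_mem_nil, or_false] at hn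
  rcases hn with rfl | rfl | rfl | rfl
  · simpa using h
  · simpa using h
  · simpa [two_zsmul] using hα
  · rw [neg_smul, two_zsmul]
    exact neg_ne_zero.mpr hα

/-- The coboundary of the integer factor set, measuring the failure of associativity. -/
def kleinDelta (x y z : Klein) : ℤ :=
  kleinMu 1 y z + kleinMu 1 x (y * z) - kleinMu 1 x y - kleinMu 1 (x * y) z

lemma cMul_kleinMu_assoc_iff {A : Type*} [AddCommGroup A] (α : A) (p q r : Klein × A) :
    cMul (kleinMu α) p (cMul (kleinMu α) q r) = cMul (kleinMu α) (cMul (kleinMu α) p q) r ↔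
      kleinDelta p.1 q.1 r.1 • α = 0 := by
  simp only [cMul, Prod.mk.injEq, mul_assoc, true_and, kleinDelta, sub_smul, add_smul,
    ← kleinMu_eq_zsmul]
  rw [← sub_eq_zero]
  refine Eq.congr ?_ rfl
  abel

lemma cMul_bijective_left {G A : Type*} [Group G] [AddCommGroup A] (μ : G → G → A) (p : G × A) :
    Function.Bijective (cMul μ p) := by
  refine ⟨fun q r h => ?_, fun q => ⟨(p.1⁻¹ * q.1, q.2 - p.2 - μ p.1 (p.1⁻¹ * q.1)), ?_⟩⟩
  · simp only [cMul, Prod.mk.injEq, mul_right_inj] at h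
    obtain ⟨h₁, h₂⟩ := h
    rw [h₁] at h₂
    exact Prod.ext h₁ (by simpa using h₂)
  · ext
    · simp [cMul]
    · simp only [cMul]
      abel

lemma cMul_bijective_right {G A : Type*} [Group G] [AddCommGroup A] (μ : G → G → A) (p : G × A) :
    Function.Bijective fun q => cMul μ q p := by
  refine ⟨fun q r h => ?_, fun q => ⟨(q.1 * p.1⁻¹, q.2 - p.2 - μ (q.1 * p.1⁻¹) p.1), ?_⟩⟩
  · simp only [cMul, Prod.mk.injEq, mul_left_inj] at h
    obtain ⟨h₁, h₂⟩ := h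
    rw [h₁] at h₂
    exact Prod.ext h₁ (by simpa using h₂)
  · ext
    · simp [cMul]
    · simp only [cMul]
      abel

lemma kleinMu_one_left {A : Type*} [AddCommGroup A] (α : A) (x : Klein) : kleinMu α 1 x = 0 := by
  have h : ∀ x, kleinMu (1 : ℤ) 1 x = 0 := by decide
  rw [kleinMu_eq_zsmul, h, zero_smul]

lemma kleinMu_one_right {A : Type*} [AddCommGroup A] (α : A) (x : Klein) : kleinMu α x 1 = 0 := by
  have h : ∀ x, kleinMu (1 : ℤ) x 1 = 0 := by decide
  rw [kleinMu_eq_zsmul, h, zero_smul]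

/-- The cocycle form of the C-identity. -/
lemma kleinMu_c_identity {A : Type*} [AddCommGroup A] (α : A) (x y z : Klein) :
    kleinMu α y z + kleinMu α y (y * z) + kleinMu α x (y * (y * z)) =
      kleinMu α x y + kleinMu α (x * y) y + kleinMu α (x * y * y) z := by
  have h : ∀ x y z,
      kleinMu (1 : ℤ) y z + kleinMu 1 y (y * z) + kleinMu 1 x (y * (y * z)) =
        kleinMu 1 x y + kleinMu 1 (x * y) y + kleinMu 1 (x * y * y) z := by decide
  simpa only [add_smul, ← kleinMu_eq_zsmul] using congrArg (· • α) (h x y z)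

lemma exists_kleinDelta_mem {g : Klein} (hg : g ≠ 1) :
    ∃ x y, kleinDelta g x y ∈ [1, -1, 2, -2] := by
  revert g
  decide

lemma exists_kleinDelta_flexible_mem : ∃ x y, kleinDelta x y x ∈ [1, -1, 2, -2] := by
  decide

lemma kleinDelta_one : ∀ x y,
    kleinDelta 1 x y = 0 ∧ kleinDelta x 1 y = 0 ∧ kleinDelta x y 1 = 0 := by
  decide

/-- For an abelian group `A` with an element `α` of order greater than `2`, the
extension of the Klein group by `A` via the factor set `kleinMu α` is a
noncommutative, non-flexible (hence nonassociative) C-loop whose nucleus is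
exactly `{(1, a) : a ∈ A}`. -/
theorem statement9 {A : Type*} [AddCommGroup A] (α : A) (hα : α + α ≠ 0) :
    (∀ p : Klein × A, cMul (kleinMu α) (1, 0) p = p) ∧
    (∀ p : Klein × A, cMul (kleinMu α) p (1, 0) = p) ∧
    (∀ p : Klein × A, Function.Bijective (cMul (kleinMu α) p)) ∧
    (∀ p : Klein × A, Function.Bijective fun q => cMul (kleinMu α) q p) ∧
    (∀ p q r : Klein × A,
      cMul (kleinMu α) p (cMul (kleinMu α) q (cMul (kleinMu α) q r)) =
        cMul (kleinMu α) (cMul (kleinMu α) (cMul (kleinMu α) p q) q) r) ∧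
    (∃ p q : Klein × A, cMul (kleinMu α) p q ≠ cMul (kleinMu α) q p) ∧
    (∃ p q : Klein × A,
      cMul (kleinMu α) p (cMul (kleinMu α) q p) ≠
        cMul (kleinMu α) (cMul (kleinMu α) p q) p) ∧
    ({p : Klein × A |
        (∀ x y : Klein × A,
          cMul (kleinMu α) p (cMul (kleinMu α) x y) =
            cMul (kleinMu α) (cMul (kleinMu α) p x) y) ∧
        (∀ x y : Klein × A,
          cMul (kleinMu α) x (cMul (kleinMu α) p y) =
            cMul (kleinMu α) (cMul (kleinMu α) x p) y) ∧
        (∀ x y : Klein × A,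
          cMul (kleinMu α) x (cMul (kleinMu α) y p) =
            cMul (kleinMu α) (cMul (kleinMu α) x y) p)} =
      {p : Klein × A | p.1 = 1}) := by
  refine ⟨fun p => ?_, fun p => ?_, cMul_bijective_left _, cMul_bijective_right _,
    fun p q r => ?_, ⟨(vK, 0), (uK, 0), fun h => ?_⟩, ?_, ?_⟩
  · simp [cMul, kleinMu_one_left]
  · simp [cMul, kleinMu_one_right]
  · refine Prod.ext (by simp only [cMul, mul_assoc]) ?_
    have h := kleinMu_c_identity α p.1 q.1 r.1
    simp only [cMul]
    calc _ = p.2 + q.2 + q.2 + r.2 + (kleinMu α q.1 r.1 + kleinMu α q.1 (q.1 * r.1) +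
          kleinMu α p.1 (q.1 * (q.1 * r.1))) := by abel
      _ = _ := by rw [h]; abel
  · have h₂ : kleinMu α vK uK = kleinMu α uK vK := by simpa [cMul] using congrArg Prod.snd h
    have hz : kleinMu (1 : ℤ) vK uK - kleinMu 1 uK vK ∈ [1, -1, 2, -2] := by decide
    refine zsmul_ne_zero_of_add_self_ne_zero hα hz ?_
    rw [sub_smul, ← kleinMu_eq_zsmul, ← kleinMu_eq_zsmul, h₂, sub_self]
  · obtain ⟨x, y, hxy⟩ := exists_kleinDelta_flexible_mem
    exact ⟨(x, 0), (y, 0), fun h =>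
      zsmul_ne_zero_of_add_self_ne_zero hα hxy ((cMul_kleinMu_assoc_iff α _ _ _).1 h)⟩
  · ext p
    simp only [Set.mem_ofPred_eq, cMul_kleinMu_assoc_iff]
    refine ⟨fun ⟨h, _, _⟩ => ?_, fun hp => ?_⟩
    · by_contra hp
      obtain ⟨x, y, hxy⟩ := exists_kleinDelta_mem hp
      exact zsmul_ne_zero_of_add_self_ne_zero hα hxy (h (x, 0) (y, 0))
    · simp [hp, kleinDelta_one]
end

section
/- Every LC-loop is power associative: for every element x of an LC-loop, every product of n copies of x, under any parenthesization, equals the left-normed power x^n; equivalently, x^m · x^n = x^{m+n} for all m, n ≥ 0, where x^0 = e and x^{n+1} = x·x^n. -/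
/-- Left-normed powers in a loop: `x^0 = 1`, `x^(n+1) = x * x^n`. -/
def lpow {L : Type*} [Loop L] (x : L) : ℕ → L
  | 0 => 1
  | n + 1 => x * lpow x n

/-- LC-loops are power associative: `x^m · x^n = x^(m+n)` for all `m, n ≥ 0`,
so all powers of `x` are well-defined. -/
theorem statement10 {L : Type*} [Loop L]
    (hLC : ∀ x y z : L, (x * x) * (y * z) = (x * (x * y)) * z) :
    ∀ (x : L) (m n : ℕ), lpow x m * lpow x n = lpow x (m + n) := by
  have left_alt : ∀ x y : L, (x * x) * y = x * (x * y) := fun x y => by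
    simpa only [Loop.mul_one] using hLC x y 1
  intro x m n
  induction m using Nat.twoStepInduction with
  | zero => rw [Nat.zero_add]; exact Loop.one_mul _
  | one =>
    rw [Nat.add_comm]
    change (x * 1) * lpow x n = x * lpow x n
    rw [Loop.mul_one]
  | more m ih _ =>
    rw [Nat.add_right_comm]
    change (x * (x * lpow x m)) * lpow x n = x * (x * lpow x (m + n))
    rw [← hLC, ih, left_alt]
end

section
/- Every LC-loop is left power alternative: for every x, y in an LC-loop and every n ≥ 0, x^n · y = L_x^n(y), i.e., x^n · y equals the result of applying left multiplication by x to y exactly n times (so x^n·y = x·(x·(···(x·y)···)) with n factors x). -/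
/-- LC-loops satisfy the left alternative law. -/
theorem Loop.left_alternative_of_LC {L : Type*} [Loop L]
    (hLC : ∀ x y z : L, (x * x) * (y * z) = (x * (x * y)) * z) (x y : L) :
    (x * x) * y = x * (x * y) := by
  simpa only [Loop.mul_one] using hLC x y 1

/-- LC-loops are left power alternative: `x^n · y` equals the `n`-fold iterate of
left translation by `x` applied to `y`. -/
theorem statement11 {L : Type*} [Loop L]
    (hLC : ∀ x y z : L, (x * x) * (y * z) = (x * (x * y)) * z) :
    ∀ (x y : L) (n : ℕ), lpow x n * y = (fun z => x * z)^[n] y := by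
  intro x y n
  induction n using Nat.twoStepInduction with
  | zero => exact Loop.one_mul y
  | one => simp only [lpow, Loop.mul_one, Function.iterate_one]
  | more n ih _ =>
    rw [Function.iterate_succ_apply', Function.iterate_succ_apply', ← ih]
    simp only [lpow]
    rw [← hLC, Loop.left_alternative_of_LC hLC]
end

section
/- Every flexible C-loop is an ARIF loop: if L is a C-loop satisfying x·(y·x) = (x·y)·x for all x, y, then L satisfies (z·x)·(y·(x·y)) = (z·(x·(y·x)))·y for all x, y, z. -/
namespace Loop

variable {L : Type*} [Loop L]

/-- C-loops have the inverse property. -/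
theorem exists_inverse_of_cLoop (hC : ∀ x y z : L, x * (y * (y * z)) = ((x * y) * y) * z) :
    ∃ i : L → L, (∀ y u, i y * (y * u) = u) ∧ (∀ y u, (u * y) * i y = u) ∧
      (∀ y u, y * (i y * u) = u) ∧ ∀ y u, (u * i y) * y = u := by
  choose i hi using fun y : L => (mulLeft_bijective y).2 1
  choose j hj using fun y : L => (mulRight_bijective y).2 1
  simp only at hi hj
  have hright : ∀ y u, (u * y) * i y = u := by
    intro y u
    apply (mulRight_bijective y).1
    obtain ⟨v, rfl⟩ := (mulRight_bijective y).2 u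
    have h := hC v y (i y)
    rw [hi, mul_one] at h
    simp only
    rw [← h]
  have hleft : ∀ y u, j y * (y * u) = u := by
    intro y u
    obtain ⟨v, rfl⟩ := (mulLeft_bijective y).2 u
    have h := hC (j y) y v
    rwa [hj, one_mul] at h
  have hji : j = i := by
    funext y
    have h := hleft y (i y)
    rwa [hi, mul_one] at h
  subst hji
  refine ⟨j, hleft, hright, fun y u => ?_, fun y u => ?_⟩
  · obtain ⟨v, rfl⟩ := (mulLeft_bijective y).2 u
    simp only [hleft]
  · obtain ⟨v, rfl⟩ := (mulRight_bijective y).2 u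
    simp only [hright]

/-- Squares in a C-loop lie in the middle nucleus. -/
theorem mul_sq_mul_of_cLoop (hC : ∀ x y z : L, x * (y * (y * z)) = ((x * y) * y) * z)
    (x y z : L) : x * ((y * y) * z) = (x * (y * y)) * z := by
  have hl : y * (y * z) = (y * y) * z := by simpa only [one_mul] using hC 1 y z
  have hr : x * (y * y) = (x * y) * y := by simpa only [mul_one] using hC x y 1
  rw [← hl, hr, hC]

/-- The inverse map of an inverse property loop reverses products. -/
theorem inverse_mul {i : L → L} (hl : ∀ y u, i y * (y * u) = u)
    (hr : ∀ y u, (u * y) * i y = u) (x y : L) : i (x * y) = i y * i x := by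
  have h := hl (x * y) (i y)
  rw [hr] at h
  rw [← h, hr]

/-- Squares in a C-loop lie in the left nucleus. -/
theorem sq_mul_mul_of_cLoop (hC : ∀ x y z : L, x * (y * (y * z)) = ((x * y) * y) * z)
    (y x z : L) : ((y * y) * x) * z = (y * y) * (x * z) := by
  obtain ⟨i, hl, hr, hl', hr'⟩ := exists_inverse_of_cLoop hC
  have h := mul_sq_mul_of_cLoop hC (i x) (i y) ((y * y) * (x * z))
  rw [← inverse_mul hl hr y y, hl, hl, ← inverse_mul hl hr] at h
  have h2 := hl' ((y * y) * x) ((y * y) * (x * z))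
  rwa [← h] at h2

/-- Squares in a C-loop lie in the right nucleus. -/
theorem mul_mul_sq_of_cLoop (hC : ∀ x y z : L, x * (y * (y * z)) = ((x * y) * y) * z)
    (z x y : L) : (z * x) * (y * y) = z * (x * (y * y)) := by
  obtain ⟨i, hl, hr, hl', hr'⟩ := exists_inverse_of_cLoop hC
  have h := mul_sq_mul_of_cLoop hC ((z * x) * (y * y)) (i y) (i x)
  rw [← inverse_mul hl hr y y, hr, hr, ← inverse_mul hl hr] at h
  have h2 := hr' (x * (y * y)) ((z * x) * (y * y))
  rw [h] at h2
  exact h2.symm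

end Loop

/-- Flexible C-loops are ARIF loops: they satisfy `(z·x)·(y·(x·y)) = (z·(x·(y·x)))·y`. -/
theorem statement12 {L : Type*} [Loop L]
    (hC : ∀ x y z : L, x * (y * (y * z)) = ((x * y) * y) * z)
    (hflex : ∀ x y : L, x * (y * x) = (x * y) * x) :
    ∀ x y z : L, (z * x) * (y * (x * y)) = (z * (x * (y * x))) * y := by
  obtain ⟨i, hl, hr, hl', hr'⟩ := Loop.exists_inverse_of_cLoop hC
  intro x y z
  have hsandwich : ∀ a b : L, a * (b * a) = ((a * b) * (a * b)) * i b := fun a b => by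
    have h := hr (a * b) (a * b)
    rw [Loop.inverse_mul hl hr] at h
    have h2 := congrArg (· * a) h
    simp only [Loop.sq_mul_mul_of_cLoop hC, hr'] at h2
    rw [hflex, h2]
  have hconj : x * ((y * x) * (y * x)) = ((x * y) * (x * y)) * x := by
    have h : x * ((y * x) * (y * x)) = (x * (y * x)) * (y * x) := by
      simpa only [Loop.mul_one] using hC x (y * x) 1
    rw [h, hsandwich, Loop.sq_mul_mul_of_cLoop hC, hl]
  rw [hsandwich y x, hsandwich x y, Loop.mul_sq_mul_of_cLoop hC,
    Loop.mul_mul_sq_of_cLoop hC, hconj, Loop.mul_sq_mul_of_cLoop hC, hr,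
    Loop.mul_sq_mul_of_cLoop hC, hr']
end

section
/- Every flexible C-loop is diassociative; in particular, every commutative C-loop is diassociative: for any two elements a, b of a commutative C-loop L, the subloop of L generated by a and b is a group (any product formed from a and b is independent of the parenthesization). -/
/-- A subloop of a loop: a subset containing `1`, closed under multiplication, and
closed under both divisions (solutions of `x * z = y` and `z * x = y` with `x, y ∈ S`
lie in `S`). -/
def IsSubloop {L : Type*} [Loop L] (S : Set L) : Prop :=
  (1 : L) ∈ S ∧ (∀ x ∈ S, ∀ y ∈ S, x * y ∈ S) ∧
  (∀ x ∈ S, ∀ y ∈ S, ∀ z : L, x * z = y → z ∈ S) ∧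
  (∀ x ∈ S, ∀ y ∈ S, ∀ z : L, z * x = y → z ∈ S)

/-- The subloop generated by a subset: the intersection of all subloops containing it. -/
def subloopClosure {L : Type*} [Loop L] (T : Set L) : Set L :=
  ⋂₀ {S : Set L | IsSubloop S ∧ T ⊆ S}

namespace Loop

variable {L : Type*} [Loop L]

/-- The right inverse of an element of a loop. -/
noncomputable def rinv (x : L) : L := ((mulLeft_bijective x).2 1).choose

theorem mul_rinv (x : L) : x * rinv x = 1 := ((mulLeft_bijective x).2 1).choose_spec

/-- Membership in the nucleus of a loop. -/
structure Nuclear (n : L) : Prop where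
  left : ∀ x y : L, (n * x) * y = n * (x * y)
  mid : ∀ x y : L, (x * n) * y = x * (n * y)
  right : ∀ x y : L, (x * y) * n = x * (y * n)

theorem nuclear_one : Nuclear (1 : L) := by
  constructor <;> simp [one_mul, mul_one]

theorem Nuclear.mul {m n : L} (hm : Nuclear m) (hn : Nuclear n) : Nuclear (m * n) where
  left x y := by rw [hm.left, hm.left, hn.left, hm.left]
  mid x y := by rw [← hm.mid, hn.mid, hm.mid, hm.left]
  right x y := by rw [← hn.right, hm.right, hn.right, hn.right]

namespace IsCLoop

theorem left_alt (h : IsCLoop L) (y z : L) : y * (y * z) = (y * y) * z := by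
  simpa [one_mul] using h 1 y z

theorem right_alt (h : IsCLoop L) (x y : L) : (x * y) * y = x * (y * y) := by
  simpa [mul_one] using (h x y 1).symm

theorem mul_rinv_cancel_right (h : IsCLoop L) (u y : L) : (u * y) * rinv y = u := by
  obtain ⟨x, rfl⟩ := (mulRight_bijective y).2 u
  simpa [mul_rinv, mul_one] using (h x y (rinv y)).symm

theorem rinv_mul (h : IsCLoop L) (y : L) : rinv y * y = 1 := by
  obtain ⟨x, hx⟩ := (mulRight_bijective y).2 1
  have hx : x * y = 1 := hx
  have := h.mul_rinv_cancel_right x y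
  rw [hx, one_mul] at this
  rw [this, hx]

theorem rinv_mul_cancel_left (h : IsCLoop L) (y w : L) : rinv y * (y * w) = w := by
  obtain ⟨z, rfl⟩ := (mulLeft_bijective y).2 w
  simpa [h.rinv_mul, one_mul] using h (rinv y) y z

theorem eq_rinv (h : IsCLoop L) {x y : L} (hxy : x * y = 1) : y = rinv x := by
  rw [← h.rinv_mul_cancel_left x y, hxy, mul_one]

theorem rinv_rinv (h : IsCLoop L) (x : L) : rinv (rinv x) = x :=
  (h.eq_rinv (h.rinv_mul x)).symm

theorem mul_rinv_cancel_left (h : IsCLoop L) (y w : L) : y * (rinv y * w) = w := by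
  simpa [h.rinv_rinv] using h.rinv_mul_cancel_left (rinv y) w

theorem rinv_mul_cancel_right (h : IsCLoop L) (u y : L) : (u * rinv y) * y = u := by
  simpa [h.rinv_rinv] using h.mul_rinv_cancel_right u (rinv y)

theorem rinv_mul_rev (h : IsCLoop L) (x y : L) : rinv (x * y) = rinv y * rinv x := by
  have h₁ := h.rinv_mul_cancel_left (x * y) (rinv y)
  rw [h.mul_rinv_cancel_right] at h₁
  rw [← h₁, h.mul_rinv_cancel_right]

theorem nuclear_of_mid (h : IsCLoop L) {n : L} (hn : ∀ x y : L, (x * n) * y = x * (n * y)) :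
    Nuclear n where
  mid := hn
  left x y := by
    have h₁ := hn (rinv (n * x)) (x * y)
    rw [h.rinv_mul_rev n x, h.rinv_mul_cancel_right, h.rinv_mul_cancel_left, ← h.rinv_mul_rev] at h₁
    conv_lhs => rw [h₁]
    rw [h.mul_rinv_cancel_left]
  right x y := by
    have h₁ := hn (x * y) (rinv (y * n))
    rw [h.rinv_mul_rev y n, h.mul_rinv_cancel_left, h.mul_rinv_cancel_right, ← h.rinv_mul_rev] at h₁
    conv_rhs => rw [← h₁]
    rw [h.rinv_mul_cancel_right]

theorem nuclear_sq (h : IsCLoop L) (y : L) : Nuclear (y * y) :=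
  h.nuclear_of_mid fun x z => by rw [← h.left_alt, h x y z, h.right_alt]

theorem nuclear_rinv (h : IsCLoop L) {n : L} (hn : Nuclear n) : Nuclear (rinv n) :=
  h.nuclear_of_mid fun x y => by
    have := hn.mid (x * rinv n) (rinv n * y)
    rw [h.rinv_mul_cancel_right, h.mul_rinv_cancel_left] at this
    exact this.symm

theorem nuclear_conj (h : IsCLoop L) {n : L} (hn : Nuclear n) (x : L) :
    Nuclear ((x * n) * rinv x) := by
  have h₁ : Nuclear ((x * n) * x) := by
    have := (h.nuclear_sq (x * n)).mul (h.nuclear_rinv hn)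
    rwa [← hn.right, h.mul_rinv_cancel_right] at this
  have h₂ := h₁.mul (h.nuclear_rinv (h.nuclear_sq x))
  rwa [(h.nuclear_rinv (h.nuclear_sq x)).right, h.rinv_mul_rev, h.mul_rinv_cancel_left] at h₂

theorem exists_nuclear_mul_eq (h : IsCLoop L) {n : L} (hn : Nuclear n) (x : L) :
    ∃ m, Nuclear m ∧ x * n = m * x :=
  ⟨_, h.nuclear_conj hn x, (h.rinv_mul_cancel_right _ _).symm⟩

theorem exists_mul_nuclear_eq (h : IsCLoop L) {n : L} (hn : Nuclear n) (x : L) :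
    ∃ m, Nuclear m ∧ n * x = x * m :=
  ⟨rinv x * (n * x), by simpa [h.rinv_rinv, hn.mid] using h.nuclear_conj hn (rinv x),
    (h.mul_rinv_cancel_left _ _).symm⟩

end IsCLoop

/-- Two elements are congruent when they lie in the same right coset of the nucleus. -/
def NucEq (x y : L) : Prop := ∃ n, Nuclear n ∧ x = n * y

theorem NucEq.refl (x : L) : NucEq x x := ⟨1, nuclear_one, (one_mul x).symm⟩

theorem NucEq.trans {x y z : L} : NucEq x y → NucEq y z → NucEq x z := by
  rintro ⟨n, hn, rfl⟩ ⟨m, hm, rfl⟩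
  exact ⟨n * m, hn.mul hm, (hn.left _ _).symm⟩

theorem Nuclear.nucEq_one {n : L} (hn : Nuclear n) : NucEq n 1 := ⟨n, hn, (mul_one n).symm⟩

namespace IsCLoop

theorem nucEq_symm (h : IsCLoop L) {x y : L} : NucEq x y → NucEq y x := by
  rintro ⟨n, hn, rfl⟩
  exact ⟨rinv n, h.nuclear_rinv hn, (h.rinv_mul_cancel_left _ _).symm⟩

theorem nucEq_mul (h : IsCLoop L) {x x' y y' : L} :
    NucEq x x' → NucEq y y' → NucEq (x * y) (x' * y') := by
  rintro ⟨n, hn, rfl⟩ ⟨m, hm, rfl⟩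
  obtain ⟨k, hk, e⟩ := h.exists_nuclear_mul_eq hm x'
  exact ⟨n * k, hn.mul hk, by rw [hn.left, ← hm.mid, e, hk.left, hn.left]⟩

theorem sq_nucEq_one (h : IsCLoop L) (x : L) : NucEq (x * x) 1 := (h.nuclear_sq x).nucEq_one

theorem rinv_nucEq (h : IsCLoop L) (x : L) : NucEq (rinv x) x :=
  ⟨rinv (x * x), h.nuclear_rinv (h.nuclear_sq x), by
    rw [h.rinv_mul_rev, h.rinv_mul_cancel_right]⟩

theorem mul_nucEq_comm (h : IsCLoop L) (x y : L) : NucEq (x * y) (y * x) := by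
  refine (h.nucEq_symm (h.rinv_nucEq (x * y))).trans ?_
  rw [h.rinv_mul_rev]
  exact h.nucEq_mul (h.rinv_nucEq y) (h.rinv_nucEq x)

theorem mul_mul_nucEq_right (h : IsCLoop L) (x y : L) : NucEq (x * (x * y)) y :=
  ⟨x * x, h.nuclear_sq x, h.left_alt x y⟩

theorem assoc_congr_left {x x' y z : L} (hx : NucEq x x')
    (e : (x' * y) * z = x' * (y * z)) : (x * y) * z = x * (y * z) := by
  obtain ⟨n, hn, rfl⟩ := hx
  rw [hn.left, hn.left, e, hn.left]

theorem assoc_congr_mid (h : IsCLoop L) {x y y' z : L} (hy : NucEq y y')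
    (e : (x * y') * z = x * (y' * z)) : (x * y) * z = x * (y * z) := by
  obtain ⟨n, hn, rfl⟩ := hy
  obtain ⟨k, hk, e'⟩ := h.exists_nuclear_mul_eq hn x
  rw [← hn.mid, hn.left, ← hn.mid, e', hk.left, hk.left, e, hk.left]

theorem assoc_congr_right (h : IsCLoop L) {x y z z' : L} (hz : NucEq z z')
    (e : (x * y) * z' = x * (y * z')) : (x * y) * z = x * (y * z) := by
  obtain ⟨n, hn, rfl⟩ := hz
  obtain ⟨k, hk, e'⟩ := h.exists_mul_nuclear_eq hn z'
  rw [e', ← hk.right, ← hk.right, ← hk.right, e]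

theorem assoc_of_nucEq_mul (h : IsCLoop L) {x y z : L} (hz : NucEq z (x * y)) :
    (x * y) * z = x * (y * z) := by
  refine h.assoc_congr_right hz ?_
  have := h.right_alt (rinv x) (x * y)
  rw [h.rinv_mul_cancel_left] at this
  rw [this, h.mul_rinv_cancel_left]

/-- The union of the cosets of the nucleus represented by `1`, `a`, `b` and `a * b`. -/
def kleinCosets (a b : L) : Set L :=
  {x | NucEq x 1 ∨ NucEq x a ∨ NucEq x b ∨ NucEq x (a * b)}

theorem mul_mem_kleinCosets (h : IsCLoop L) {a b x y : L} (hx : x ∈ kleinCosets a b)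
    (hy : y ∈ kleinCosets a b) : x * y ∈ kleinCosets a b := by
  have haab := h.mul_mul_nucEq_right a b
  have haba := (h.mul_nucEq_comm (a * b) a).trans haab
  have hbab : NucEq (b * (a * b)) a :=
    (h.nucEq_mul (.refl b) (h.mul_nucEq_comm a b)).trans (h.mul_mul_nucEq_right b a)
  have habb := (h.mul_nucEq_comm (a * b) b).trans hbab
  have hba := h.mul_nucEq_comm b a
  have h₁ := h.sq_nucEq_one a
  have h₂ := h.sq_nucEq_one b
  have h₃ := h.sq_nucEq_one (a * b)
  rcases hx with hx | hx | hx | hx <;> rcases hy with hy | hy | hy | hy <;>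
    have hxy := h.nucEq_mul hx hy <;> try simp only [one_mul, mul_one] at hxy
  all_goals first
    | exact .inl hxy
    | exact .inr (.inl hxy)
    | exact .inr (.inr (.inl hxy))
    | exact .inr (.inr (.inr hxy))
    | exact .inl (hxy.trans ‹_›)
    | exact .inr (.inl (hxy.trans ‹_›))
    | exact .inr (.inr (.inl (hxy.trans ‹_›)))
    | exact .inr (.inr (.inr (hxy.trans ‹_›)))

theorem rinv_mem_kleinCosets (h : IsCLoop L) {a b x : L} (hx : x ∈ kleinCosets a b) :
    rinv x ∈ kleinCosets a b := by
  exact hx.imp (h.rinv_nucEq x).trans (Or.imp (h.rinv_nucEq x).trans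
    (Or.imp (h.rinv_nucEq x).trans (h.rinv_nucEq x).trans))

theorem isSubloop_kleinCosets (h : IsCLoop L) (a b : L) : IsSubloop (kleinCosets a b) := by
  refine ⟨.inl (.refl 1), fun x hx y hy => h.mul_mem_kleinCosets hx hy, ?_, ?_⟩
  · rintro x hx _ hy z rfl
    simpa [h.rinv_mul_cancel_left] using h.mul_mem_kleinCosets (h.rinv_mem_kleinCosets hx) hy
  · rintro x hx _ hy z rfl
    simpa [h.mul_rinv_cancel_right] using h.mul_mem_kleinCosets hy (h.rinv_mem_kleinCosets hx)

theorem subloopClosure_subset_kleinCosets (h : IsCLoop L) (a b : L) :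
    subloopClosure {a, b} ⊆ kleinCosets a b := by
  refine Set.sInter_subset_of_mem ⟨h.isSubloop_kleinCosets a b, ?_⟩
  rintro x (rfl | rfl)
  · exact .inr (.inl (.refl _))
  · exact .inr (.inr (.inl (.refl _)))

theorem assoc_of_mem_kleinCosets (h : IsCLoop L)
    (hflex : ∀ x y : L, x * (y * x) = (x * y) * x) {a b x y z : L}
    (hx : x ∈ kleinCosets a b) (hy : y ∈ kleinCosets a b) (hz : z ∈ kleinCosets a b) :
    (x * y) * z = x * (y * z) := by
  have haab := h.mul_mul_nucEq_right a b
  have haba := (h.mul_nucEq_comm (a * b) a).trans haab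
  have hbab : NucEq (b * (a * b)) a :=
    (h.nucEq_mul (.refl b) (h.mul_nucEq_comm a b)).trans (h.mul_mul_nucEq_right b a)
  have habb := (h.mul_nucEq_comm (a * b) b).trans hbab
  have hba := h.mul_nucEq_comm a b
  rcases hx with hx | hx | hx | hx <;> rcases hy with hy | hy | hy | hy <;>
    rcases hz with hz | hz | hz | hz <;>
    refine assoc_congr_left hx (h.assoc_congr_mid hy (h.assoc_congr_right hz ?_))
  all_goals first
    | simp only [one_mul, mul_one]
    | exact (h.left_alt _ _).symm
    | exact h.right_alt _ _
    | exact (hflex _ _).symm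
    | exact h.assoc_of_nucEq_mul (.refl _)
    | exact h.assoc_of_nucEq_mul (h.nucEq_symm ‹_›)
    | exact h.assoc_of_nucEq_mul ‹_›

end IsCLoop

end Loop


/-- Flexible C-loops are diassociative; in particular, commutative C-loops are
diassociative: any subloop generated by two elements is associative (hence a group). -/
theorem statement13 {L : Type*} [Loop L]
    (hC : ∀ x y z : L, x * (y * (y * z)) = ((x * y) * y) * z) :
    ((∀ x y : L, x * (y * x) = (x * y) * x) →
      ∀ a b : L, ∀ x ∈ subloopClosure {a, b}, ∀ y ∈ subloopClosure {a, b},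
        ∀ z ∈ subloopClosure {a, b}, (x * y) * z = x * (y * z)) ∧
    ((∀ x y : L, x * y = y * x) →
      ∀ a b : L, ∀ x ∈ subloopClosure {a, b}, ∀ y ∈ subloopClosure {a, b},
        ∀ z ∈ subloopClosure {a, b}, (x * y) * z = x * (y * z)) := by
  have h : Loop.IsCLoop L := hC
  have key (hflex : ∀ x y : L, x * (y * x) = (x * y) * x) (a b : L) :
      ∀ x ∈ subloopClosure {a, b}, ∀ y ∈ subloopClosure {a, b},
        ∀ z ∈ subloopClosure {a, b}, (x * y) * z = x * (y * z) := fun x hx y hy z hz =>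
    h.assoc_of_mem_kleinCosets hflex (h.subloopClosure_subset_kleinCosets a b hx)
      (h.subloopClosure_subset_kleinCosets a b hy) (h.subloopClosure_subset_kleinCosets a b hz)
  exact ⟨key, fun hcomm => key fun x y => by rw [hcomm x (y * x), hcomm y x]⟩
end

section
/- Let L be a finite loop that is left power alternative and has the left inverse property. Then L has the strong monogenic Lagrange property: for every x ∈ L, the order of the subloop ⟨x⟩ generated by x divides the order of L (and the same holds inside every subloop of L). -/
namespace Loop

variable {L : Type*} [Loop L]

theorem surjOn_of_mapsTo_of_injective {α : Type*} [Finite α] {f : α → α} {S : Set α}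
    (hf : Set.MapsTo f S S) (hinj : Function.Injective f) : Set.SurjOn f S S :=
  hf.restrict_surjective_iff.1 (Finite.surjective_of_injective (hf.restrict_inj.2 hinj.injOn))

theorem IsSubloop.of_mul_mem [Finite L] {S : Set L} (h1 : (1 : L) ∈ S)
    (hmul : ∀ x ∈ S, ∀ y ∈ S, x * y ∈ S) : IsSubloop S := by
  refine ⟨h1, hmul, fun x hx y hy z hz => ?_, fun x hx y hy z hz => ?_⟩
  · obtain ⟨w, hw, hxw⟩ := surjOn_of_mapsTo_of_injective
      (f := fun b => x * b) (fun b hb => hmul x hx b hb) (mulLeft_bijective x).injective hy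
    exact (mulLeft_bijective x).injective (hz.trans hxw.symm) ▸ hw
  · obtain ⟨w, hw, hwx⟩ := surjOn_of_mapsTo_of_injective
      (f := fun b => b * x) (fun b hb => hmul b hb x hx) (mulRight_bijective x).injective hy
    exact (mulRight_bijective x).injective (hz.trans hwx.symm) ▸ hw

theorem lpow_mem {S : Set L} (hS : IsSubloop S) {x : L} (hx : x ∈ S) (n : ℕ) :
    lpow x n ∈ S := by
  induction n with
  | zero => exact hS.1
  | succ n ih => exact hS.2.1 _ hx _ ih

theorem lpow_eq_iterate (x : L) (n : ℕ) : lpow x n = (fun z => x * z)^[n] 1 := by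
  induction n with
  | zero => rfl
  | succ n ih => rw [Function.iterate_succ_apply', ← ih]; rfl

theorem subloopClosure_singleton [Finite L] {x : L}
    (hx : ∀ (n : ℕ) (y : L), lpow x n * y = (fun z => x * z)^[n] y) :
    subloopClosure {x} = Set.range (lpow x) := by
  apply Set.Subset.antisymm
  · refine Set.sInter_subset_of_mem ⟨IsSubloop.of_mul_mem ⟨0, rfl⟩ ?_, ?_⟩
    · rintro _ ⟨m, rfl⟩ _ ⟨n, rfl⟩
      refine ⟨m + n, ?_⟩
      rw [hx, lpow_eq_iterate, lpow_eq_iterate, Function.iterate_add_apply]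
    · rintro _ rfl
      exact ⟨1, mul_one _⟩
  · rintro _ ⟨n, rfl⟩ S ⟨hS, hxS⟩
    exact lpow_mem hS (hxS rfl) n

/-- Left translation by an element of a subloop, as a permutation of the subloop. -/
noncomputable def mulLeftPerm {S : Set L} (hS : IsSubloop S) {x : L} (hx : x ∈ S) :
    Equiv.Perm S :=
  Equiv.ofBijective (fun y => ⟨x * y, hS.2.1 x hx y y.2⟩)
    ⟨fun _ _ h => Subtype.ext ((mulLeft_bijective x).injective (congrArg Subtype.val h)),
      fun y => by
        obtain ⟨z, hz⟩ := (mulLeft_bijective x).surjective y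
        exact ⟨⟨z, hS.2.2.1 x hx y y.2 z hz⟩, Subtype.ext hz⟩⟩

theorem coe_mulLeftPerm_pow {S : Set L} (hS : IsSubloop S) {x : L} (hx : x ∈ S) (n : ℕ)
    (y : S) : ((mulLeftPerm hS hx ^ n) y : L) = (fun z => x * z)^[n] y := by
  induction n with
  | zero => rfl
  | succ n ih => rw [pow_succ', Function.iterate_succ_apply', ← ih]; rfl

/-- The group generated by a left translation acts freely. -/
theorem stabilizer_zpowers_mulLeftPerm [Finite L] {S : Set L} (hS : IsSubloop S) {x : L}
    (hx : x ∈ S) (hpow : ∀ (n : ℕ) (y : L), lpow x n * y = (fun z => x * z)^[n] y) (y : S) :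
    MulAction.stabilizer (Subgroup.zpowers (mulLeftPerm hS hx)) y = ⊥ := by
  refine (Subgroup.eq_bot_iff_forall _).2 ?_
  rintro ⟨g, hg⟩ hgy
  obtain ⟨n, rfl⟩ := mem_powers_iff_mem_zpowers.2 hg
  have hy : (mulLeftPerm hS hx ^ n) y = y := hgy
  have h1 : lpow x n = 1 := by
    apply (mulRight_bijective (y : L)).injective
    change lpow x n * y = 1 * y
    rw [hpow, ← coe_mulLeftPerm_pow hS hx, hy, one_mul]
  refine Subtype.ext (Equiv.ext fun z => Subtype.ext ?_)
  change ((mulLeftPerm hS hx ^ n) z : L) = z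
  rw [coe_mulLeftPerm_pow, ← hpow, h1, one_mul]

theorem card_zpowers_mulLeftPerm [Finite L] {S : Set L} (hS : IsSubloop S) {x : L}
    (hx : x ∈ S) (hpow : ∀ (n : ℕ) (y : L), lpow x n * y = (fun z => x * z)^[n] y) :
    Nat.card (Subgroup.zpowers (mulLeftPerm hS hx)) = Nat.card (subloopClosure {x}) := by
  have hval (n : ℕ) : ((mulLeftPerm hS hx ^ n) ⟨1, hS.1⟩ : L) = lpow x n := by
    rw [coe_mulLeftPerm_pow, lpow_eq_iterate]
  rw [subloopClosure_singleton hpow]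
  refine Nat.card_congr (Equiv.ofBijective
    (fun g => ⟨(g.1 ⟨1, hS.1⟩ : L), ?_⟩) ⟨fun g h hgh => ?_, ?_⟩)
  · obtain ⟨n, hn⟩ := mem_powers_iff_mem_zpowers.2 g.2
    exact ⟨n, by rw [← hn]; exact (hval n).symm⟩
  · have hval_eq : (g.1 ⟨1, hS.1⟩ : L) = h.1 ⟨1, hS.1⟩ :=
      congrArg (fun p : Set.range (lpow x) => (p : L)) hgh
    have hgh' : g • (⟨1, hS.1⟩ : S) = h • ⟨1, hS.1⟩ := Subtype.ext hval_eq
    have hmem : h⁻¹ * g ∈ MulAction.stabilizer _ (⟨1, hS.1⟩ : S) := by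
      rw [MulAction.mem_stabilizer_iff, mul_smul, hgh', inv_smul_smul]
    rw [stabilizer_zpowers_mulLeftPerm hS hx hpow, Subgroup.mem_bot] at hmem
    exact (inv_mul_eq_one.1 hmem).symm
  · rintro ⟨_, n, rfl⟩
    exact ⟨⟨_, Subgroup.npow_mem_zpowers _ n⟩, Subtype.ext (hval n)⟩

end Loop

/-- A finite left power alternative loop with the left inverse property has the
strong monogenic Lagrange property: inside every subloop `S`, the order of the
subloop generated by any element `x ∈ S` divides the order of `S`. -/
theorem statement14 {L : Type*} [Loop L] [Finite L]
    (hlpa : ∀ (x : L) (n : ℕ) (y : L), lpow x n * y = (fun z => x * z)^[n] y)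
    (hlip : ∀ x : L, ∃ x' : L, x' * x = 1 ∧ ∀ y : L, x' * (x * y) = y) :
    ∀ S : Set L, IsSubloop S → ∀ x ∈ S,
      Nat.card (subloopClosure {x}) ∣ Nat.card S := by
  intro S hS x hx
  rw [← Loop.card_zpowers_mulLeftPerm hS hx (hlpa x),
    Nat.card_congr (MulAction.selfEquivOrbitsQuotientProd
      (Loop.stabilizer_zpowers_mulLeftPerm hS hx (hlpa x))), Nat.card_prod]
  exact dvd_mul_left _ _
end

section
/- Let L be a commutative loop with the inverse property satisfying both alternative laws (x·(x·y) = (x·x)·y and (y·x)·x = y·(x·x)). Then (x·y)·(x·y) = (x·x)·(y·y) for all x, y ∈ L; that is, the squaring map x ↦ x·x is an endomorphism of L. -/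
/-- In a commutative, alternative, inverse property loop, `(x·y)² = x²·y²`:
squaring is an endomorphism. -/
theorem statement15 {L : Type*} [Loop L]
    (hcomm : ∀ x y : L, x * y = y * x)
    (hinv : ∃ inv : L → L, ∀ x : L, inv x * x = 1 ∧ x * inv x = 1 ∧
      (∀ y : L, inv x * (x * y) = y) ∧ (∀ y : L, (y * x) * inv x = y))
    (hla : ∀ x y : L, x * (x * y) = (x * x) * y)
    (hra : ∀ x y : L, (y * x) * x = y * (x * x)) :
    ∀ x y : L, (x * y) * (x * y) = (x * x) * (y * y) := by
  obtain ⟨inv, h⟩ := hinv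
  intro x y
  have hx : (x * y) * inv y = x := (h y).2.2.2 x
  apply (Loop.mulRight_bijective (inv y)).1
  calc ((x * y) * (x * y)) * inv y
      = (x * y) * ((x * y) * inv y) := (hla _ _).symm
    _ = x * (x * y) := by rw [hx, hcomm]
    _ = (x * x) * y := hla x y
    _ = (((x * x) * y) * y) * inv y := ((h y).2.2.2 _).symm
    _ = ((x * x) * (y * y)) * inv y := by rw [hra]
end

section
/- Let L be a commutative C-loop and let A be the subloop of L generated by all associators [x,y,z] (defined by (x·y)·z = (x·(y·z))·[x,y,z]). Then A has exponent at most 2: a·a = e for every a ∈ A. In particular, ((x·y)·z)·((x·y)·z) = (x·(y·z))·(x·(y·z)) for all x, y, z ∈ L. -/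
/-- The set of associators of a loop: `a` is an associator if
`(x·y)·z = (x·(y·z))·a` for some `x, y, z`. -/
def associatorSet (L : Type*) [Loop L] : Set L :=
  {a | ∃ x y z : L, (x * y) * z = (x * (y * z)) * a}

namespace Loop

variable {L : Type*} [Loop L]

theorem exists_inverse (hC : ∀ x y z : L, x * (y * (y * z)) = ((x * y) * y) * z) (y : L) :
    ∃ y' : L, y * y' = 1 ∧ ∀ w : L, (w * y) * y' = w := by
  obtain ⟨y', hy' : y * y' = 1⟩ := (mulLeft_bijective y).2 1
  refine ⟨y', hy', fun w => ?_⟩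
  obtain ⟨x, rfl : x * y = w⟩ := (mulRight_bijective y).2 w
  rw [← hC, hy', mul_one]

/-- In a commutative C-loop squares lie in the left nucleus. -/
theorem mul_self_mul_assoc (hC : ∀ x y z : L, x * (y * (y * z)) = ((x * y) * y) * z)
    (hcomm : ∀ x y : L, x * y = y * x) (y x z : L) :
    ((y * y) * x) * z = (y * y) * (x * z) := by
  have left_alt (y z : L) : y * (y * z) = (y * y) * z := by
    simpa only [one_mul] using hC 1 y z
  have middle (x y z : L) : x * ((y * y) * z) = (x * (y * y)) * z := by
    rw [← left_alt, hC, hcomm (x * y), hcomm x y, left_alt, hcomm (y * y)]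
  choose inv mul_inv mul_inv_cancel using exists_inverse hC
  have inv_mul_cancel (a b : L) : inv a * (a * b) = b := by
    rw [hcomm, hcomm a, mul_inv_cancel]
  have mul_inv_cancel_left (a b : L) : a * (inv a * b) = b := by
    obtain ⟨c, rfl : a * c = b⟩ := (mulLeft_bijective a).2 b
    rw [inv_mul_cancel]
  have inv_mul (a b : L) : inv (a * b) = inv b * inv a := by
    rw [← inv_mul_cancel b (inv (a * b))]
    congr 1
    rw [← mul_inv_cancel (a * b) (inv a), inv_mul_cancel]
  have inv_inv (a : L) : inv (inv a) = a := by
    apply (mulLeft_bijective (inv a)).1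
    change inv a * inv (inv a) = inv a * a
    rw [mul_inv, hcomm, mul_inv]
  have key (c x t : L) (hc : ∀ x z : L, x * (c * z) = (x * c) * z) :
      (inv c * inv x) * t = inv c * (inv x * t) := by
    rw [← inv_mul]
    apply (mulLeft_bijective (x * c)).1
    change (x * c) * (inv (x * c) * t) = (x * c) * (inv c * (inv x * t))
    rw [mul_inv_cancel_left, ← hc, mul_inv_cancel_left, mul_inv_cancel_left]
  have h := key (inv y * inv y) (inv x) z fun a b => middle a (inv y) b
  simpa only [inv_mul, inv_inv] using h

theorem mul_mul_self (hC : ∀ x y z : L, x * (y * (y * z)) = ((x * y) * y) * z)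
    (hcomm : ∀ x y : L, x * y = y * x) (x y : L) :
    (x * y) * (x * y) = (x * x) * (y * y) := by
  have nuc := mul_self_mul_assoc hC hcomm
  choose inv mul_inv mul_inv_cancel using exists_inverse hC
  have self_eq (a : L) : a = (a * a) * inv a := (mul_inv_cancel a a).symm
  have inv_mul_inv : (inv y * inv x) * (x * y) = 1 := by
    have h : inv y * inv x = inv (x * y) := by
      rw [← mul_inv_cancel (x * y) (inv x), hcomm (inv x), hcomm x y, mul_inv_cancel,
        hcomm y, hcomm (inv y), hcomm y, mul_inv_cancel]
    rw [h, hcomm, mul_inv]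
  have h : x * y = (x * x) * ((y * y) * (inv y * inv x)) := by
    rw [← nuc y, ← self_eq y, hcomm y, ← nuc x, ← self_eq x]
  calc (x * y) * (x * y)
      = ((x * x) * ((y * y) * (inv y * inv x))) * (x * y) := by rw [← h]
    _ = (x * x) * (y * y) := by rw [nuc, nuc, inv_mul_inv, mul_one]

end Loop

/-- In a commutative C-loop, the subloop generated by all associators has
exponent at most `2`; in particular `((x·y)·z)² = (x·(y·z))²`. -/
theorem statement17 {L : Type*} [Loop L]
    (hC : ∀ x y z : L, x * (y * (y * z)) = ((x * y) * y) * z)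
    (hcomm : ∀ x y : L, x * y = y * x) :
    (∀ a ∈ subloopClosure (associatorSet L), a * a = 1) ∧
    ∀ x y z : L,
      ((x * y) * z) * ((x * y) * z) = (x * (y * z)) * (x * (y * z)) := by
  have sq := Loop.mul_mul_self hC hcomm
  have sq_assoc (x y z : L) :
      ((x * y) * z) * ((x * y) * z) = (x * (y * z)) * (x * (y * z)) := by
    rw [sq (x * y), sq x y, sq x, sq y, Loop.mul_self_mul_assoc hC hcomm]
  have right_of_mul {x y z : L} (hx : x * x = 1) (hy : y * y = 1) (h : x * z = y) :
      z * z = 1 := by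
    rw [← Loop.one_mul (z * z), ← hx, ← sq, h, hy, hx]
  refine ⟨fun a ha => ?_, sq_assoc⟩
  refine ha {a | a * a = 1} ⟨⟨Loop.one_mul 1, ?_, ?_, ?_⟩, ?_⟩
  · intro x (hx : x * x = 1) y (hy : y * y = 1)
    change (x * y) * (x * y) = 1
    rw [sq, hx, hy, Loop.one_mul]
  · exact fun x hx y hy z h => right_of_mul hx hy h
  · exact fun x hx y hy z h => right_of_mul hx hy (hcomm x z ▸ h)
  · rintro a ⟨x, y, z, h⟩
    apply (Loop.mulLeft_bijective ((x * (y * z)) * (x * (y * z)))).1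
    change _ * (a * a) = _ * 1
    rw [← sq, ← h, sq_assoc, Loop.mul_one]
end

section
/- Decomposition of torsion commutative C-loops: let L be a commutative C-loop in which every element has finite order, let U = {x ∈ L : the order of x is a power of 2} and V = {x ∈ L : the order of x is odd}. Then U and V are normal subloops of L, V is contained in the nucleus of L (hence V is an abelian group), U ∩ V = {e}, U·V = L, and L is isomorphic to the direct product U × V. In particular, every torsion commutative C-loop is the direct product of a torsion abelian group and a torsion commutative C-loop of 2-power exponent elements. -/
/-- A normal subloop: a subloop `S` with `x·S = S·x`, `x·(y·S) = (x·y)·S` and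
`x·(S·y) = (x·S)·y` for all `x, y`. -/
def IsNormalSubloop {L : Type*} [Loop L] (S : Set L) : Prop :=
  IsSubloop S ∧ ∀ x y : L,
    ((fun n => x * n) '' S = (fun n => n * x) '' S) ∧
    ((fun n => x * (y * n)) '' S = (fun n => (x * y) * n) '' S) ∧
    ((fun n => x * (n * y)) '' S = (fun n => (x * n) * y) '' S)

/-- The order of an element of a loop: the least `n > 0` with `x^n = 1`. -/
noncomputable def loopOrder {L : Type*} [Loop L] (x : L) : ℕ :=
  sInf {n : ℕ | 0 < n ∧ lpow x n = 1}

/-- Commutative C-loops. -/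
class IsCommCLoop (L : Type*) [Loop L] : Prop where
  mul_mul_mul (x y z : L) : x * (y * (y * z)) = ((x * y) * y) * z
  mul_comm (x y : L) : x * y = y * x

namespace IsCommCLoop

variable {L : Type*} [Loop L]

theorem mul_left_cancel {a b c : L} (h : a * b = a * c) : b = c :=
  (Loop.mulLeft_bijective a).injective h

theorem exists_mul_eq (a b : L) : ∃ x, a * x = b :=
  (Loop.mulLeft_bijective a).surjective b

theorem exists_mul_eq' (a b : L) : ∃ x, x * a = b :=
  (Loop.mulRight_bijective a).surjective b

theorem lpow_one (x : L) : lpow x 1 = x := Loop.mul_one x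

theorem one_lpow (n : ℕ) : lpow (1 : L) n = 1 := by
  induction n with
  | zero => rfl
  | succ n ih => rw [lpow, ih, Loop.one_mul]

theorem lpow_loopOrder {x : L} (hx : ∃ n : ℕ, 0 < n ∧ lpow x n = 1) :
    0 < loopOrder x ∧ lpow x (loopOrder x) = 1 :=
  Nat.sInf_mem hx

variable [IsCommCLoop L]

theorem mul_self_mul (y z : L) : (y * y) * z = y * (y * z) := by
  simpa only [Loop.one_mul] using (mul_mul_mul 1 y z).symm

theorem mul_mul_self (x y : L) : x * (y * y) = (x * y) * y := by
  simpa only [Loop.mul_one] using mul_mul_mul x y 1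

/-- Commutative C-loops have the inverse property. -/
theorem exists_inv : ∃ i : L → L, ∀ x w : L, i x * (x * w) = w ∧ x * (i x * w) = w := by
  choose i hi using fun y : L ↦ exists_mul_eq y 1
  have h (y w : L) : i y * (y * w) = w := by
    obtain ⟨x, rfl⟩ := exists_mul_eq' y w
    have := mul_mul_mul x y (i y)
    rw [hi, Loop.mul_one] at this
    rw [mul_comm y, mul_comm (i y), ← this]
  refine ⟨i, fun x w ↦ ⟨h x w, ?_⟩⟩
  obtain ⟨v, rfl⟩ := exists_mul_eq x w
  rw [h]

theorem mem_nucleus_of_middle {a : L} (ha : ∀ x z : L, x * (a * z) = (x * a) * z) :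
    a ∈ nucleus L := by
  obtain ⟨i, hi⟩ := exists_inv (L := L)
  have right (w z : L) : w * (z * a) = (w * z) * a := by
    have h₁ : a * i (z * a) = i z := by
      apply mul_left_cancel (a := z)
      rw [ha, ← Loop.mul_one (i (z * a)), (hi _ _).2, ← Loop.mul_one (i z), (hi _ _).2]
    have h₂ : ((w * z) * a) * i (z * a) = w := by
      rw [← ha, h₁, mul_comm w z, mul_comm, (hi _ _).1]
    apply mul_left_cancel (a := i (z * a))
    rw [mul_comm _ ((w * z) * a), h₂, mul_comm w, (hi _ _).1]
  refine ⟨fun x y ↦ ?_, ha, right⟩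
  rw [mul_comm a (x * y), mul_comm x y, ← right, mul_comm x a, mul_comm y]

theorem mul_self_mem_nucleus (y : L) : y * y ∈ nucleus L :=
  mem_nucleus_of_middle fun x z ↦ by rw [mul_self_mul, mul_mul_mul, mul_mul_self]

theorem mul_mul_mul_comm_of_mem_nucleus {a b : L} (ha : a ∈ nucleus L) (hb : b ∈ nucleus L)
    (x y : L) : (a * b) * (x * y) = (a * x) * (b * y) := by
  rw [← ha.1, ← ha.1, hb.1, hb.2.1, mul_comm b x]

theorem mul_mul_self_mul (x y : L) : (x * y) * (x * y) = (x * x) * (y * y) := by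
  obtain ⟨i, hi⟩ := exists_inv (L := L)
  apply mul_left_cancel (a := i x)
  rw [mul_mul_self, (hi _ _).1, (mul_self_mem_nucleus y).2.2, ← Loop.mul_one (x * x),
    mul_self_mul, (hi _ _).1, Loop.mul_one, mul_mul_self, mul_comm]

theorem lpow_add_two (x : L) (n : ℕ) : lpow x (n + 2) = (x * x) * lpow x n :=
  (mul_self_mul _ _).symm

theorem lpow_add (x : L) (m n : ℕ) : lpow x (m + n) = lpow x m * lpow x n := by
  induction m using Nat.twoStepInduction with
  | zero => rw [Nat.zero_add, lpow, Loop.one_mul]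
  | one => rw [Nat.add_comm, lpow_one, lpow]
  | more m ih _ =>
    rw [Nat.add_right_comm, lpow_add_two, lpow_add_two, ih, (mul_self_mem_nucleus x).1]

theorem lpow_mul (x : L) (m n : ℕ) : lpow x (m * n) = lpow (lpow x m) n := by
  induction n with
  | zero => rfl
  | succ n ih => rw [Nat.mul_succ, Nat.add_comm, lpow_add, ih, lpow]

theorem mul_lpow (x y : L) (n : ℕ) : lpow (x * y) n = lpow x n * lpow y n := by
  induction n using Nat.twoStepInduction with
  | zero => exact (Loop.one_mul 1).symm
  | one => simp only [lpow_one]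
  | more n ih _ =>
    rw [lpow_add_two, lpow_add_two, lpow_add_two, ih, mul_mul_self_mul,
      mul_mul_mul_comm_of_mem_nucleus (mul_self_mem_nucleus x) (mul_self_mem_nucleus y)]

theorem lpow_eq_one_of_dvd {x : L} {m n : ℕ} (h : lpow x m = 1) (hmn : m ∣ n) :
    lpow x n = 1 := by
  obtain ⟨k, rfl⟩ := hmn
  rw [lpow_mul, h, one_lpow]

theorem lpow_eq_self_of_modEq {x : L} {m n : ℕ} (h : lpow x m = 1) (hn : n ≡ 1 [MOD m]) :
    lpow x n = x := by
  have red (k : ℕ) : lpow x k = lpow x (k % m) := by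
    conv_lhs => rw [← Nat.div_add_mod k m]
    rw [lpow_add, lpow_eq_one_of_dvd h (Nat.dvd_mul_right m _), Loop.one_mul]
  rw [red, hn, ← red, lpow_one]

theorem mem_nucleus_of_odd {x : L} {n : ℕ} (hn : Odd n) (h : lpow x n = 1) :
    x ∈ nucleus L := by
  obtain ⟨k, rfl⟩ := hn
  have hx : lpow x ((k + 1) + (k + 1)) = x :=
    lpow_eq_self_of_modEq h (by simp [Nat.ModEq, show k + 1 + (k + 1) = 1 + (2 * k + 1) by ring])
  rw [lpow_add] at hx
  exact hx ▸ mul_self_mem_nucleus _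

theorem loopOrder_dvd {x : L} {n : ℕ} (hn : 0 < n) (h : lpow x n = 1) : loopOrder x ∣ n := by
  obtain ⟨hpos, hone⟩ := lpow_loopOrder ⟨n, hn, h⟩
  rw [Nat.dvd_iff_mod_eq_zero]
  by_contra hne
  refine (Nat.mod_lt n hpos).not_ge (Nat.sInf_le ⟨Nat.pos_of_ne_zero hne, ?_⟩)
  rw [← Nat.div_add_mod n (loopOrder x), lpow_add,
    lpow_eq_one_of_dvd hone (Nat.dvd_mul_right _ _), Loop.one_mul] at h
  exact h

theorem loopOrder_eq_two_pow_iff (x : L) :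
    (∃ k, loopOrder x = 2 ^ k) ↔ ∃ n ∈ Submonoid.powers 2, lpow x n = 1 := by
  constructor
  · rintro ⟨k, hk⟩
    have hx : ({n : ℕ | 0 < n ∧ lpow x n = 1}).Nonempty :=
      Nat.nonempty_of_pos_sInf (hk ▸ Nat.two_pow_pos k : 0 < loopOrder x)
    exact ⟨2 ^ k, ⟨k, rfl⟩, hk ▸ (lpow_loopOrder hx).2⟩
  · rintro ⟨_, ⟨k, rfl⟩, h⟩
    obtain ⟨j, -, hj⟩ := (Nat.dvd_prime_pow Nat.prime_two).1 (loopOrder_dvd (Nat.two_pow_pos k) h)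
    exact ⟨j, hj⟩

/-- The multiplicative monoid of odd natural numbers. -/
def oddSubmonoid : Submonoid ℕ where
  carrier := {n | Odd n}
  one_mem' := odd_one
  mul_mem' := Odd.mul

theorem odd_loopOrder_iff (x : L) :
    Odd (loopOrder x) ↔ ∃ n ∈ oddSubmonoid, lpow x n = 1 := by
  constructor
  · intro ho
    have hx : ({n : ℕ | 0 < n ∧ lpow x n = 1}).Nonempty := Nat.nonempty_of_pos_sInf ho.pos
    exact ⟨loopOrder x, ho, (lpow_loopOrder hx).2⟩
  · rintro ⟨n, hn, h⟩
    exact Odd.of_dvd_nat hn (loopOrder_dvd (Odd.pos hn) h)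

/-- The elements killed by an exponent in a multiplicative set form a normal subloop. -/
theorem isNormalSubloop_torsion (E : Submonoid ℕ) :
    IsNormalSubloop {x : L | ∃ n ∈ E, lpow x n = 1} := by
  have hdiv : ∀ x ∈ {x : L | ∃ n ∈ E, lpow x n = 1}, ∀ y ∈ {x : L | ∃ n ∈ E, lpow x n = 1},
      ∀ z : L, x * z = y → z ∈ {x : L | ∃ n ∈ E, lpow x n = 1} := by
    rintro x ⟨m, hm, hx⟩ y ⟨n, hn, hy⟩ z rfl
    refine ⟨m * n, E.mul_mem hm hn, ?_⟩
    have := lpow_eq_one_of_dvd hy (Nat.dvd_mul_left n m)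
    rwa [mul_lpow, lpow_eq_one_of_dvd hx (Nat.dvd_mul_right m n), Loop.one_mul] at this
  refine ⟨⟨⟨1, E.one_mem, one_lpow 1⟩, ?_, hdiv, ?_⟩, fun x y ↦ ⟨?_, ?_, ?_⟩⟩
  · rintro x ⟨m, hm, hx⟩ y ⟨n, hn, hy⟩
    refine ⟨m * n, E.mul_mem hm hn, ?_⟩
    rw [mul_lpow, lpow_eq_one_of_dvd hx (Nat.dvd_mul_right m n),
      lpow_eq_one_of_dvd hy (Nat.dvd_mul_left n m), Loop.one_mul]
  · intro x hx y hy z hz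
    exact hdiv x hx y hy z (mul_comm x z ▸ hz)
  · simp only [mul_comm x]
  · apply Set.Subset.antisymm
    · rintro _ ⟨a, ⟨n, hn, ha⟩, rfl⟩
      obtain ⟨b, hb⟩ := exists_mul_eq (x * y) (x * (y * a))
      refine ⟨b, ⟨n, hn, ?_⟩, hb⟩
      have := congrArg (lpow · n) hb
      simp only [mul_lpow, ha, Loop.mul_one] at this
      exact mul_left_cancel (this.trans (Loop.mul_one _).symm)
    · rintro _ ⟨a, ⟨n, hn, ha⟩, rfl⟩
      obtain ⟨c, hc⟩ := exists_mul_eq x ((x * y) * a)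
      obtain ⟨b, rfl⟩ := exists_mul_eq y c
      refine ⟨b, ⟨n, hn, ?_⟩, hc⟩
      have := congrArg (lpow · n) hc
      simp only [mul_lpow, ha, Loop.mul_one] at this
      exact mul_left_cancel ((mul_left_cancel this).trans (Loop.mul_one _).symm)
  · apply Set.Subset.antisymm
    · rintro _ ⟨a, ⟨n, hn, ha⟩, rfl⟩
      obtain ⟨c, hc⟩ := exists_mul_eq' y (x * (a * y))
      obtain ⟨b, rfl⟩ := exists_mul_eq x c
      refine ⟨b, ⟨n, hn, ?_⟩, hc⟩
      have := congrArg (lpow · n) hc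
      simp only [mul_lpow, ha, Loop.one_mul] at this
      exact mul_left_cancel
        (((Loop.mulRight_bijective _).injective this).trans (Loop.mul_one _).symm)
    · rintro _ ⟨a, ⟨n, hn, ha⟩, rfl⟩
      obtain ⟨c, hc⟩ := exists_mul_eq x ((x * a) * y)
      obtain ⟨b, rfl⟩ := exists_mul_eq' y c
      refine ⟨b, ⟨n, hn, ?_⟩, hc⟩
      have := congrArg (lpow · n) hc
      simp only [mul_lpow, ha, Loop.mul_one] at this
      exact (Loop.mulRight_bijective _).injective
        ((mul_left_cancel this).trans (Loop.one_mul _).symm)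

/-- For an exponent `e` congruent to `1` mod `m` and divisible by `n`, the `e`-th power projects
onto the factor killed by `m`. -/
theorem lpow_mul_eq_left {u v : L} {m n e : ℕ} (hu : lpow u m = 1) (hv : lpow v n = 1)
    (hm : e ≡ 1 [MOD m]) (hn : n ∣ e) : lpow (u * v) e = u := by
  rw [mul_lpow, lpow_eq_self_of_modEq hu hm, lpow_eq_one_of_dvd hv hn, Loop.mul_one]

theorem existsUnique_decomposition {z : L} (hz : ∃ n : ℕ, 0 < n ∧ lpow z n = 1) :
    ∃! p : L × L, (∃ n ∈ Submonoid.powers 2, lpow p.1 n = 1) ∧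
      (∃ n ∈ oddSubmonoid, lpow p.2 n = 1) ∧ p.1 * p.2 = z := by
  have crt (k : ℕ) {n : ℕ} (hn : Odd n) : ∃ e, e ≡ 1 [MOD 2 ^ k] ∧ n ∣ e := by
    obtain ⟨e, h₁, h₂⟩ := Nat.chineseRemainder (hn.coprime_two_left.pow_left k) 1 0
    exact ⟨e, h₁, Nat.modEq_zero_iff_dvd.1 h₂⟩
  apply existsUnique_of_exists_of_unique
  · obtain ⟨N, hN, hzN⟩ := hz
    obtain ⟨k, n, hn, rfl⟩ := Nat.exists_eq_two_pow_mul_odd hN.ne'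
    have hco : Nat.Coprime (2 ^ k) n := hn.coprime_two_left.pow_left k
    obtain ⟨e, he, hne⟩ := crt k hn
    obtain ⟨f, hf₀, hf⟩ := Nat.chineseRemainder hco 0 1
    refine ⟨(lpow z e, lpow z f), ⟨2 ^ k, ⟨k, rfl⟩, ?_⟩, ⟨n, hn, ?_⟩, ?_⟩
    · rw [← lpow_mul]
      exact lpow_eq_one_of_dvd hzN (Nat.mul_comm e _ ▸ Nat.mul_dvd_mul_left _ hne)
    · rw [← lpow_mul]
      exact lpow_eq_one_of_dvd hzN (Nat.mul_dvd_mul_right (Nat.modEq_zero_iff_dvd.1 hf₀) n)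
    · rw [← lpow_add]
      refine lpow_eq_self_of_modEq hzN ((Nat.modEq_and_modEq_iff_modEq_mul hco).1 ⟨?_, ?_⟩)
      · simpa using he.add hf₀
      · simpa using (Nat.modEq_zero_iff_dvd.2 hne).add hf
  · rintro ⟨u, v⟩ ⟨u', v'⟩ ⟨⟨_, ⟨k, rfl⟩, hu⟩, ⟨n, hn, hv⟩, huv⟩
      ⟨⟨_, ⟨k', rfl⟩, hu'⟩, ⟨n', hn', hv'⟩, huv'⟩
    dsimp only at hu hv huv hu' hv' huv'
    obtain ⟨e, he, hne⟩ := crt (k + k') (hn.mul hn')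
    have h := lpow_mul_eq_left hu hv (he.of_dvd (pow_dvd_pow 2 (Nat.le_add_right k k')))
      (dvd_of_mul_right_dvd hne)
    have h' := lpow_mul_eq_left hu' hv' (he.of_dvd (pow_dvd_pow 2 (Nat.le_add_left k' k)))
      (dvd_of_mul_left_dvd hne)
    obtain rfl : u = u' := by rw [← h, ← h', huv, huv']
    rw [mul_left_cancel (huv.trans huv'.symm)]

end IsCommCLoop

/-- Decomposition of torsion commutative C-loops: if every element of a commutative
C-loop `L` has finite order, then `U` (elements of `2`-power order) and `V` (elements
of odd order) are normal subloops, `V` lies in the nucleus (hence is an abelian group),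
`U ∩ V = {1}`, `U·V = L`, and `L` is (isomorphic to) the direct product `U × V`. -/
theorem statement19 {L : Type*} [Loop L]
    (hC : ∀ x y z : L, x * (y * (y * z)) = ((x * y) * y) * z)
    (hcomm : ∀ x y : L, x * y = y * x)
    (htor : ∀ x : L, ∃ n : ℕ, 0 < n ∧ lpow x n = 1) :
    IsNormalSubloop {x : L | ∃ k : ℕ, loopOrder x = 2 ^ k} ∧
    IsNormalSubloop {x : L | Odd (loopOrder x)} ∧
    {x : L | Odd (loopOrder x)} ⊆ nucleus L ∧
    {x : L | ∃ k : ℕ, loopOrder x = 2 ^ k} ∩ {x : L | Odd (loopOrder x)} = {1} ∧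
    (∀ z : L, ∃ u ∈ {x : L | ∃ k : ℕ, loopOrder x = 2 ^ k},
      ∃ v ∈ {x : L | Odd (loopOrder x)}, u * v = z) ∧
    (∀ z : L, ∃! p : L × L,
      p.1 ∈ {x : L | ∃ k : ℕ, loopOrder x = 2 ^ k} ∧
      p.2 ∈ {x : L | Odd (loopOrder x)} ∧ p.1 * p.2 = z) ∧
    (∀ u₁ ∈ {x : L | ∃ k : ℕ, loopOrder x = 2 ^ k},
      ∀ v₁ ∈ {x : L | Odd (loopOrder x)},
      ∀ u₂ ∈ {x : L | ∃ k : ℕ, loopOrder x = 2 ^ k},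
      ∀ v₂ ∈ {x : L | Odd (loopOrder x)},
        (u₁ * v₁) * (u₂ * v₂) = (u₁ * u₂) * (v₁ * v₂)) := by
  have : IsCommCLoop L := ⟨hC, hcomm⟩
  simp only [IsCommCLoop.loopOrder_eq_two_pow_iff, IsCommCLoop.odd_loopOrder_iff]
  have hnuc : {x : L | ∃ n ∈ IsCommCLoop.oddSubmonoid, lpow x n = 1} ⊆ nucleus L :=
    fun x ⟨_, hn, h⟩ ↦ IsCommCLoop.mem_nucleus_of_odd hn h
  have hdec (z : L) := IsCommCLoop.existsUnique_decomposition (htor z)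
  refine ⟨IsCommCLoop.isNormalSubloop_torsion _, IsCommCLoop.isNormalSubloop_torsion _, hnuc,
    ?_, fun z ↦ ?_, hdec, fun u₁ _ v₁ hv₁ u₂ _ v₂ hv₂ ↦ ?_⟩
  · have hone (E : Submonoid ℕ) : ∃ n ∈ E, lpow (1 : L) n = 1 :=
      ⟨1, E.one_mem, IsCommCLoop.one_lpow 1⟩
    apply Set.Subset.antisymm
    · rintro x ⟨hu, hv⟩
      exact congrArg Prod.fst ((hdec x).unique (y₁ := (x, 1)) (y₂ := (1, x))
        ⟨hu, hone _, Loop.mul_one x⟩ ⟨hone _, hv, Loop.one_mul x⟩)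
    · rintro _ rfl
      exact ⟨hone _, hone _⟩
  · obtain ⟨⟨u, v⟩, ⟨hu, hv, huv⟩, -⟩ := hdec z
    exact ⟨u, hu, v, hv, huv⟩
  · rw [hcomm u₁ v₁, hcomm u₂ v₂, ← IsCommCLoop.mul_mul_mul_comm_of_mem_nucleus (hnuc hv₁)
      (hnuc hv₂), hcomm]
end
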